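/- arXiv:1401.3143 — 6 statements merged into one kernel-verified Lean document; each statement's English description precedes it below -/
import Mathlib

section
/- There exists a bounded linear operator T : L²(0,∞) → L²(0,∞) such that (i) for every twice continuously differentiable f with compact support in (0,∞), Tf agrees almost everywhere with the absolutely convergent integral x ↦ √(2/π) ∫₀^∞ (cos(xt) + sin(xt)) f(t) dt; (ii) √2 ‖f‖₂ ≤ ‖Tf‖₂ ≤ 2 ‖f‖₂ for all f ∈ L²(0,∞); and (iii) T is a bijection of L²(0,∞) onto itself. -/
open MeasureTheory Set Filter
open scoped Real

/-- The half-Hartley transform of `f`. -/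
noncomputable def halfHartley (f : ℝ → ℂ) (x : ℝ) : ℂ :=
  (Real.sqrt (2 / π) : ℂ) *
    ∫ t in Ioi (0 : ℝ), ((Real.cos (x * t) + Real.sin (x * t) : ℝ) : ℂ) * f t

open scoped FourierTransform ComplexConjugate Topology

/-- The test functions: `C²` with compact support in `(0,∞)`. -/
structure HHNice (f : ℝ → ℂ) : Prop where
  smooth : ContDiff ℝ 2 f
  cpt : HasCompactSupport f
  supp : tsupport f ⊆ Ioi (0 : ℝ)

theorem HHNice.integrable {f : ℝ → ℂ} (hf : HHNice f) : Integrable f :=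
  hf.smooth.continuous.integrable_of_hasCompactSupport hf.cpt

theorem HHNice.exists_pos {f : ℝ → ℂ} (hf : HHNice f) :
    ∃ δ > 0, ∀ t, f t ≠ 0 → δ ≤ t := by
  rcases (tsupport f).eq_empty_or_nonempty with h | h
  · refine ⟨1, one_pos, fun t ht => ?_⟩
    have : t ∈ tsupport f := subset_tsupport f ht
    simp [h] at this
  · obtain ⟨δ, hδ, hl⟩ := hf.cpt.isCompact.exists_isLeast h
    exact ⟨δ, hf.supp hδ, fun t ht => hl (subset_tsupport f ht)⟩

theorem hh_bound {f : ℝ → ℂ} (hf : HHNice f) :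
    ∃ K : ℝ, ∀ ξ : ℝ, ‖𝓕 f ξ‖ ≤ K * (1 + ξ ^ 2)⁻¹ := by
  have hI : ∀ n : ℕ, (n : ℕ∞) ≤ (2 : ℕ∞) → Integrable (iteratedDeriv n f) := by
    intro n hn
    refine (hf.smooth.continuous_iteratedDeriv n (by exact_mod_cast hn)).integrable_of_hasCompactSupport ?_
    refine hf.cpt.mono' ?_
    intro x hx
    apply support_iteratedFDeriv_subset (𝕜 := ℝ) n
    rw [Function.mem_support] at hx ⊢
    rwa [← norm_ne_zero_iff, norm_iteratedFDeriv_eq_norm_iteratedDeriv, norm_ne_zero_iff]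
  have h2 := Real.fourier_iteratedDeriv (N := 2) (n := 2) hf.smooth hI (by simp)
  refine ⟨(∫ t, ‖f t‖) + ∫ t, ‖iteratedDeriv 2 f t‖, fun ξ => ?_⟩
  have b0 : ‖𝓕 f ξ‖ ≤ ∫ t, ‖f t‖ := VectorFourier.norm_fourierIntegral_le_integral_norm _ _ _ _ _
  have b2 : ‖𝓕 (iteratedDeriv 2 f) ξ‖ ≤ ∫ t, ‖iteratedDeriv 2 f t‖ :=
    VectorFourier.norm_fourierIntegral_le_integral_norm _ _ _ _ _
  rw [h2] at b2
  simp only [norm_smul, norm_pow, norm_mul, Complex.norm_I, Complex.norm_real, Complex.norm_ofNat,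
    Real.norm_eq_abs, mul_pow, sq_abs] at b2
  rw [← div_eq_mul_inv, le_div_iff₀ (by positivity)]
  have : ξ ^ 2 * ‖𝓕 f ξ‖ ≤ 2 ^ 2 * π ^ 2 * ξ ^ 2 * ‖𝓕 f ξ‖ := by
    have : 1 ≤ 2 ^ 2 * π ^ 2 := by nlinarith [Real.pi_gt_three]
    have h3 : 0 ≤ ξ ^ 2 * ‖𝓕 f ξ‖ := by positivity
    nlinarith
  nlinarith

theorem hh_cont {f : ℝ → ℂ} (hf : HHNice f) : Continuous (𝓕 f) :=
  VectorFourier.fourierIntegral_continuous Real.continuous_fourierChar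
    (by exact continuous_inner) hf.integrable

theorem hh_fint {f : ℝ → ℂ} (hf : HHNice f) : Integrable (𝓕 f) := by
  obtain ⟨K, hK⟩ := hh_bound hf
  exact (integrable_inv_one_add_sq.const_mul K).mono' (hh_cont hf).aestronglyMeasurable
    (Eventually.of_forall hK)

theorem hh_fint2 {f : ℝ → ℂ} (hf : HHNice f) : Integrable (fun ξ => ‖𝓕 f ξ‖ ^ 2) := by
  obtain ⟨K, hK⟩ := hh_bound hf
  refine ((hh_fint hf).norm.mul_const K).mono' ((hh_cont hf).norm.pow 2).aestronglyMeasurable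
    (Eventually.of_forall fun ξ => ?_)
  rw [norm_pow, norm_norm, sq]
  refine mul_le_mul_of_nonneg_left ((hK ξ).trans ?_) (norm_nonneg _)
  have hK0 : 0 ≤ K := by
    have := (norm_nonneg _).trans (hK 0)
    simpa using this
  have : (1 + ξ ^ 2)⁻¹ ≤ 1 := inv_le_one_of_one_le₀ (by nlinarith [sq_nonneg ξ])
  nlinarith

theorem hh_plancherel {f : ℝ → ℂ} (hf : HHNice f) :
    ∫ ξ, ‖𝓕 f ξ‖ ^ 2 = ∫ t, ‖f t‖ ^ 2 := by
  have h1 : ∫ ξ, inner ℂ (𝓕 f ξ) (𝓕 f ξ) = ∫ x, inner ℂ (f x) (𝓕⁻ (𝓕 f) x) := by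
    simpa [Real.fourierInv_eq, Real.fourier_eq, VectorFourier.fourierIntegral] using! VectorFourier.integral_sesq_fourierIntegral_eq_neg_flip
      (innerSL ℂ) (L := innerₗ ℝ) Real.continuous_fourierChar continuous_inner hf.integrable
      (hh_fint hf)
  rw [hf.smooth.continuous.fourierInv_fourier_eq hf.integrable (hh_fint hf)] at h1
  apply Complex.ofRealLI.injective
  simpa [← LinearIsometry.integral_comp_comm, inner_self_eq_norm_sq_to_K] using h1

noncomputable def hhC (f : ℝ → ℂ) (x : ℝ) : ℂ := ∫ t, (Real.cos (x * t) : ℂ) * f t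
noncomputable def hhS (f : ℝ → ℂ) (x : ℝ) : ℂ := ∫ t, (Real.sin (x * t) : ℂ) * f t

theorem hh_cint {f : ℝ → ℂ} (hf : HHNice f) (x : ℝ) :
    Integrable (fun t => (Real.cos (x * t) : ℂ) * f t) :=
  hf.integrable.bdd_mul (c := 1) (by fun_prop)
    (Eventually.of_forall fun t => by rw [Complex.norm_real]; exact Real.abs_cos_le_one _)

theorem hh_sint {f : ℝ → ℂ} (hf : HHNice f) (x : ℝ) :
    Integrable (fun t => (Real.sin (x * t) : ℂ) * f t) :=
  hf.integrable.bdd_mul (c := 1) (by fun_prop)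
    (Eventually.of_forall fun t => by rw [Complex.norm_real]; exact Real.abs_sin_le_one _)

theorem hh_four {f : ℝ → ℂ} (hf : HHNice f) (x : ℝ) :
    𝓕 f (x * (2 * π)⁻¹) = hhC f x - Complex.I * hhS f x := by
  rw [hhC, hhS, ← integral_const_mul, ← integral_sub (hh_cint hf x) ((hh_sint hf x).const_mul _),
    Real.fourier_real_eq_integral_exp_smul]
  congr 1 with t
  have : (((-2 * π * t * (x * (2 * π)⁻¹) : ℝ) : ℂ) * Complex.I) = ((-(x * t) : ℝ) : ℂ) * Complex.I := by
    congr 2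
    field_simp
  rw [this, Complex.exp_mul_I, smul_eq_mul, ← Complex.ofReal_cos, ← Complex.ofReal_sin,
    Real.cos_neg, Real.sin_neg]
  push_cast
  ring

theorem hhC_neg (f : ℝ → ℂ) (x : ℝ) : hhC f (-x) = hhC f x := by simp [hhC]
theorem hhS_neg (f : ℝ → ℂ) (x : ℝ) : hhS f (-x) = -hhS f x := by
  simp [hhS, integral_neg]

noncomputable def hhG (f : ℝ → ℂ) (x : ℝ) : ℝ := ‖hhC f x‖ ^ 2 + ‖hhS f x‖ ^ 2

theorem hhG_eq {f : ℝ → ℂ} (hf : HHNice f) (x : ℝ) :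
    hhG f x = 2⁻¹ * (‖𝓕 f (x * (2 * π)⁻¹)‖ ^ 2 + ‖𝓕 f (-x * (2 * π)⁻¹)‖ ^ 2) := by
  rw [hh_four hf, hh_four hf, hhC_neg, hhS_neg, hhG]
  simp only [← Complex.normSq_eq_norm_sq, Complex.normSq_apply]
  simp
  ring

theorem hhG_int {f : ℝ → ℂ} (hf : HHNice f) :
    Integrable (hhG f) ∧ ∫ x in Ioi (0:ℝ), hhG f x = π * ∫ t, ‖f t‖ ^ 2 := by
  have hp : (2 * π)⁻¹ ≠ 0 := by positivity
  have i1 : Integrable (fun x => ‖𝓕 f (x * (2 * π)⁻¹)‖ ^ 2) :=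
    (hh_fint2 hf).comp_mul_right' hp
  have i2 : Integrable (fun x => ‖𝓕 f (-x * (2 * π)⁻¹)‖ ^ 2) := i1.comp_neg
  have hG : hhG f = fun x => 2⁻¹ * (‖𝓕 f (x * (2 * π)⁻¹)‖ ^ 2 + ‖𝓕 f (-x * (2 * π)⁻¹)‖ ^ 2) :=
    funext (hhG_eq hf)
  have j1 : ∫ x, ‖𝓕 f (x * (2 * π)⁻¹)‖ ^ 2 = 2 * π * ∫ t, ‖f t‖ ^ 2 := by
    rw [Measure.integral_comp_mul_right (fun y => ‖𝓕 f y‖ ^ 2), hh_plancherel hf, inv_inv,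
      abs_of_pos (by positivity), smul_eq_mul]
  have j2 : ∫ x, ‖𝓕 f (-x * (2 * π)⁻¹)‖ ^ 2 = 2 * π * ∫ t, ‖f t‖ ^ 2 := by
    rw [← j1, integral_neg_eq_self (fun x => ‖𝓕 f (x * (2 * π)⁻¹)‖ ^ 2)]
  refine ⟨?_, ?_⟩
  · rw [hG]; exact (i1.add i2).const_mul _
  · have h1 : ∫ x, hhG f x = 2 * π * ∫ t, ‖f t‖ ^ 2 := by
      rw [hG, integral_const_mul, integral_add i1 i2, j1, j2]; ring
    have h2 : ∫ x, hhG f |x| = 2 * ∫ x in Ioi (0:ℝ), hhG f x := integral_comp_abs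
    have h3 : ∀ x, hhG f |x| = hhG f x := by
      intro x
      rcases abs_choice x with h | h <;> rw [h]
      simp [hhG, hhC_neg, hhS_neg]
    simp_rw [h3] at h2
    linarith

/-- The exponential transform `∫ f(t) e^{zt} dt`. -/
noncomputable def hhL (f : ℝ → ℂ) (z : ℂ) : ℂ := ∫ t, f t * Complex.exp (z * t)

/-- The tensor `f(t) conj f(s)`. -/
noncomputable def hhT (f : ℝ → ℂ) (p : ℝ × ℝ) : ℂ := f p.1 * conj (f p.2)

theorem hhT_int {f : ℝ → ℂ} (hf : HHNice f) : Integrable (hhT f) := by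
  have h2 : Integrable (fun t => conj (f t)) := by
    simpa using (Complex.conjLIE.integrable_comp_iff).2 hf.integrable
  exact hf.integrable.mul_prod h2

theorem hhT_ne {f : ℝ → ℂ} {δ : ℝ} (hδ : ∀ t, f t ≠ 0 → δ ≤ t) (p : ℝ × ℝ) (h : hhT f p ≠ 0) :
    δ ≤ p.1 ∧ δ ≤ p.2 := by
  unfold hhT at h
  refine ⟨hδ _ (left_ne_zero_of_mul h), hδ _ fun h0 => ?_⟩
  simp [h0] at h

theorem hhL_mul (f : ℝ → ℂ) (z : ℂ) :
    hhL f z * hhL (fun t => conj (f t)) z =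
      ∫ p : ℝ × ℝ, hhT f p * Complex.exp (z * (p.1 + p.2 : ℝ)) := by
  rw [hhL, hhL, ← integral_prod_mul]
  congr 1 with p
  rw [hhT]
  push_cast
  rw [mul_add, Complex.exp_add]
  ring

theorem hh_fubini {f : ℝ → ℂ} (hf : HHNice f) {w : ℂ} (hw : w.re ≤ 0) {ε : ℝ} (hε : 0 < ε) :
    ∫ x in Ioi (0:ℝ), Complex.exp (-ε * x) *
        (hhL f (w * x) * hhL (fun t => conj (f t)) (w * x)) =
      ∫ p : ℝ × ℝ, hhT f p * (ε - w * (p.1 + p.2 : ℝ))⁻¹ := by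
  obtain ⟨δ, hδ0, hδ⟩ := hf.exists_pos
  simp_rw [hhL_mul, ← integral_const_mul]
  have hexp : IntegrableOn (fun x : ℝ => Complex.exp (-ε * x)) (Ioi (0:ℝ)) := by
    simpa using integrableOn_exp_mul_complex_Ioi (a := -ε) (by simpa using hε) 0
  rw [integral_integral_swap]
  · congr 1 with p
    by_cases h0 : hhT f p = 0
    · simp [h0]
    obtain ⟨h1, h2⟩ := hhT_ne hδ p h0
    have hre : (-ε + w * (p.1 + p.2 : ℝ)).re < 0 := by
      simp only [Complex.add_re, Complex.neg_re, Complex.ofReal_re, Complex.re_mul_ofReal]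
      nlinarith [mul_nonneg (neg_nonneg.2 hw) (by linarith : (0:ℝ) ≤ p.1 + p.2)]
    have := integral_exp_mul_complex_Ioi hre 0
    rw [show (ε - w * (p.1 + p.2 : ℝ) : ℂ)⁻¹ = - Complex.exp ((-ε + w * (p.1 + p.2 : ℝ)) * (0:ℝ)) / (-ε + w * (p.1 + p.2 : ℝ)) by
      rw [show (-ε + w * (p.1 + p.2 : ℝ) : ℂ) = -(ε - w * (p.1 + p.2 : ℝ)) by ring]
      rw [Complex.ofReal_zero, mul_zero, Complex.exp_zero, neg_div_neg_eq, one_div], ← this, ← integral_const_mul]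
    congr 1 with x
    rw [add_mul, Complex.exp_add]
    rw [show w * (x:ℂ) * ((p.1 + p.2 : ℝ) : ℂ) = w * ((p.1 + p.2 : ℝ) : ℂ) * x by ring]
    ring
  · have hb : Integrable (fun q : ℝ × (ℝ × ℝ) => Complex.exp (-ε * q.1) * hhT f q.2)
        ((volume.restrict (Ioi (0:ℝ))).prod volume) := hexp.mul_prod (hhT_int hf)
    refine hb.norm.mono' ?_ ?_
    · have hm : AEStronglyMeasurable (fun q : ℝ × (ℝ × ℝ) => hhT f q.2)
        ((volume.restrict (Ioi (0:ℝ))).prod volume) := (hhT_int hf).1.comp_snd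
      refine AEStronglyMeasurable.mul (Continuous.aestronglyMeasurable (by fun_prop)) ?_
      exact AEStronglyMeasurable.mul hm (Continuous.aestronglyMeasurable (by fun_prop))
    · have hx : ∀ᵐ q : ℝ × (ℝ × ℝ) ∂((volume.restrict (Ioi (0:ℝ))).prod volume), q.1 ∈ Ioi (0:ℝ) :=
        Measure.quasiMeasurePreserving_fst.ae (ae_restrict_mem measurableSet_Ioi)
      filter_upwards [hx] with q hq
      simp only [Function.uncurry, norm_mul]
      refine mul_le_mul_of_nonneg_left ?_ (norm_nonneg _)
      by_cases h0 : hhT f q.2 = 0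
      · simp [h0]
      obtain ⟨h1, h2⟩ := hhT_ne hδ _ h0
      refine mul_le_of_le_one_right (norm_nonneg _) ?_
      rw [Complex.norm_exp, Real.exp_le_one_iff, Complex.re_mul_ofReal, Complex.re_mul_ofReal]
      have : (0:ℝ) < q.1 := hq
      nlinarith [mul_nonneg (mul_nonneg (neg_nonneg.2 hw) this.le) (by linarith : (0:ℝ) ≤ q.2.1 + q.2.2)]

theorem hh_limit {f : ℝ → ℂ} (hf : HHNice f) {w : ℂ} (hw : w.re ≤ 0) (hw0 : w ≠ 0) :
    Tendsto (fun ε : ℝ => ∫ p : ℝ × ℝ, hhT f p * (ε - w * (p.1 + p.2 : ℝ))⁻¹) (𝓝[>] 0)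
      (𝓝 ((-w)⁻¹ * ∫ p : ℝ × ℝ, hhT f p * ((p.1 + p.2 : ℝ) : ℂ)⁻¹)) := by
  obtain ⟨δ, hδ0, hδ⟩ := hf.exists_pos
  rw [← integral_const_mul]
  refine tendsto_integral_filter_of_dominated_convergence (fun p => ‖hhT f p‖ * (‖w‖ * δ)⁻¹)
    ?_ ?_ ((hhT_int hf).norm.mul_const _) ?_
  · refine Eventually.of_forall fun ε => (hhT_int hf).1.mul ?_
    exact Measurable.aestronglyMeasurable (by fun_prop)
  · filter_upwards [self_mem_nhdsWithin] with ε hε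
    refine Eventually.of_forall fun p => ?_
    have hε' : 0 < ε := hε
    rw [norm_mul]
    by_cases h0 : hhT f p = 0
    · simp [h0]
    obtain ⟨h1, h2⟩ := hhT_ne hδ p h0
    refine mul_le_mul_of_nonneg_left ?_ (norm_nonneg _)
    rw [norm_inv]
    refine inv_anti₀ (mul_pos (norm_pos_iff.2 hw0) hδ0) ?_
    refine abs_le_of_sq_le_sq' ?_ (norm_nonneg _) |>.2
    rw [mul_pow, ← Complex.normSq_eq_norm_sq, ← Complex.normSq_eq_norm_sq, Complex.normSq_apply,
      Complex.normSq_apply]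
    simp only [Complex.sub_re, Complex.sub_im, Complex.ofReal_re, Complex.ofReal_im,
      Complex.re_mul_ofReal, Complex.im_mul_ofReal]
    have ha : δ ≤ p.1 + p.2 := by linarith
    have hsq : δ ^ 2 ≤ (p.1 + p.2) ^ 2 := by gcongr
    have := mul_nonneg (mul_nonneg (neg_nonneg.2 hw) hε'.le) (by linarith : (0:ℝ) ≤ p.1 + p.2)
    nlinarith [mul_le_mul_of_nonneg_left hsq (add_nonneg (mul_self_nonneg w.re) (mul_self_nonneg w.im)), sq_nonneg ε]
  · refine Eventually.of_forall fun p => ?_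
    by_cases h0 : hhT f p = 0
    · simp [h0]
    obtain ⟨h1, h2⟩ := hhT_ne hδ p h0
    have hne : w * ((p.1 + p.2 : ℝ) : ℂ) ≠ 0 :=
      mul_ne_zero hw0 (Complex.ofReal_ne_zero.2 (by linarith))
    have : Tendsto (fun ε : ℝ => hhT f p * ((ε : ℂ) - w * (p.1 + p.2 : ℝ))⁻¹) (𝓝 0)
        (𝓝 (hhT f p * (((0 : ℝ) : ℂ) - w * (p.1 + p.2 : ℝ))⁻¹)) := by
      refine Tendsto.const_mul _ (Tendsto.inv₀ ?_ (by simpa using hne))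
      exact (Complex.continuous_ofReal.tendsto 0).sub_const _
    convert this.mono_left nhdsWithin_le_nhds using 2
    rw [Complex.ofReal_zero, zero_sub, ← neg_mul, mul_inv]
    ring

/-- Positivity of the Carleman form. -/
theorem hh_carleman {f : ℝ → ℂ} (hf : HHNice f) :
    0 ≤ (∫ p : ℝ × ℝ, hhT f p * ((p.1 + p.2 : ℝ) : ℂ)⁻¹).re := by
  have h := hh_limit hf (w := -1) (by simp) (by simp)
  have h' := (Complex.continuous_re.tendsto _).comp h
  simp only [neg_neg, inv_one, one_mul] at h'
  refine ge_of_tendsto h' ?_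
  filter_upwards [self_mem_nhdsWithin] with ε hε
  simp only [Function.comp]
  rw [← hh_fubini hf (w := -1) (by simp) hε]
  have key : ∀ x : ℝ, Complex.exp (-ε * x) *
        (hhL f (-1 * x) * hhL (fun t => conj (f t)) (-1 * x)) =
        ((Real.exp (-ε * x) * ‖hhL f (-1 * x)‖ ^ 2 : ℝ) : ℂ) := by
    intro x
    have : hhL (fun t => conj (f t)) (-1 * x) = conj (hhL f (-1 * x)) := by
      rw [hhL, hhL, ← integral_conj]
      congr 1 with t
      rw [map_mul, ← Complex.exp_conj]
      simp
    rw [this, Complex.mul_conj, Complex.normSq_eq_norm_sq]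
    push_cast
    rfl
  simp_rw [key]
  rw [integral_complex_ofReal, Complex.ofReal_re]
  exact integral_nonneg fun x => by positivity

theorem hhL_I {f : ℝ → ℂ} (hf : HHNice f) (x : ℝ) :
    hhL f (Complex.I * x) = hhC f x + Complex.I * hhS f x := by
  rw [hhC, hhS, ← integral_const_mul, ← integral_add (hh_cint hf x) ((hh_sint hf x).const_mul _), hhL]
  congr 1 with t
  rw [show Complex.I * x * t = ((x * t : ℝ) : ℂ) * Complex.I by push_cast; ring, Complex.exp_mul_I,
    ← Complex.ofReal_cos, ← Complex.ofReal_sin]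
  ring

theorem HHNice.conj {f : ℝ → ℂ} (hf : HHNice f) : HHNice (fun t => conj (f t)) where
  smooth := Complex.conjCLE.contDiff.comp hf.smooth
  cpt := hf.cpt.comp_left (g := conj) (by simp)
  supp := (closure_mono (Function.support_comp_subset (g := conj) (by simp) f)).trans hf.supp

theorem hhC_conj (f : ℝ → ℂ) (x : ℝ) : hhC (fun t => conj (f t)) x = conj (hhC f x) := by
  rw [hhC, hhC, ← integral_conj]
  congr 1 with t
  rw [map_mul, Complex.conj_ofReal]

theorem hhS_conj (f : ℝ → ℂ) (x : ℝ) : hhS (fun t => conj (f t)) x = conj (hhS f x) := by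
  rw [hhS, hhS, ← integral_conj]
  congr 1 with t
  rw [map_mul, Complex.conj_ofReal]

theorem hhC_cont {f : ℝ → ℂ} (hf : HHNice f) : Continuous (hhC f) := by
  refine continuous_of_dominated (bound := fun t => ‖f t‖) (fun x => (hh_cint hf x).1) ?_
    hf.integrable.norm (Eventually.of_forall fun t => by fun_prop)
  refine fun x => Eventually.of_forall fun t => ?_
  rw [norm_mul, Complex.norm_real]
  exact mul_le_of_le_one_left (norm_nonneg _) (Real.abs_cos_le_one _)

theorem hhS_cont {f : ℝ → ℂ} (hf : HHNice f) : Continuous (hhS f) := by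
  refine continuous_of_dominated (bound := fun t => ‖f t‖) (fun x => (hh_sint hf x).1) ?_
    hf.integrable.norm (Eventually.of_forall fun t => by fun_prop)
  refine fun x => Eventually.of_forall fun t => ?_
  rw [norm_mul, Complex.norm_real]
  exact mul_le_of_le_one_left (norm_nonneg _) (Real.abs_sin_le_one _)

/-- The product of the two exponential transforms on the imaginary axis. -/
noncomputable def hhP (f : ℝ → ℂ) (x : ℝ) : ℂ :=
  (hhC f x + Complex.I * hhS f x) * (conj (hhC f x) + Complex.I * conj (hhS f x))

theorem hhP_norm (f : ℝ → ℂ) (x : ℝ) : ‖hhP f x‖ ≤ 2 * hhG f x := by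
  rw [hhP, norm_mul, hhG]
  have h1 : ‖hhC f x + Complex.I * hhS f x‖ ≤ ‖hhC f x‖ + ‖hhS f x‖ :=
    (norm_add_le _ _).trans (by simp)
  have h2 : ‖conj (hhC f x) + Complex.I * conj (hhS f x)‖ ≤ ‖hhC f x‖ + ‖hhS f x‖ :=
    (norm_add_le _ _).trans (by simp)
  refine (mul_le_mul h1 h2 (norm_nonneg _) (by positivity)).trans ?_
  nlinarith [sq_nonneg (‖hhC f x‖ - ‖hhS f x‖)]

theorem hhP_int {f : ℝ → ℂ} (hf : HHNice f) : Integrable (hhP f) := by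
  have hC := hhC_cont hf
  have hS := hhS_cont hf
  refine ((hhG_int hf).1.const_mul 2).mono' ?_ (Eventually.of_forall (hhP_norm f))
  refine Continuous.aestronglyMeasurable ?_
  unfold hhP
  fun_prop

theorem hhP_im (f : ℝ → ℂ) (x : ℝ) : ‖hhC f x + hhS f x‖ ^ 2 = hhG f x + (hhP f x).im := by
  simp only [hhG, hhP, ← Complex.normSq_eq_norm_sq, Complex.normSq_apply]
  simp
  ring

theorem hhP_nonneg {f : ℝ → ℂ} (hf : HHNice f) : 0 ≤ ∫ x in Ioi (0:ℝ), (hhP f x).im := by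
  have h := hh_limit hf (w := Complex.I) (by simp) (by simp)
  have h2 : Tendsto (fun ε : ℝ => ∫ x in Ioi (0:ℝ), Complex.exp (-ε * x) * hhP f x) (𝓝[>] 0)
      (𝓝 (∫ x in Ioi (0:ℝ), hhP f x)) := by
    refine tendsto_integral_filter_of_dominated_convergence (fun x => ‖hhP f x‖) ?_ ?_
      (hhP_int hf).norm.integrableOn ?_
    · refine Eventually.of_forall fun ε => AEStronglyMeasurable.mul
        (Continuous.aestronglyMeasurable (by fun_prop)) (hhP_int hf).integrableOn.1
    · filter_upwards [self_mem_nhdsWithin] with ε hε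
      filter_upwards [ae_restrict_mem measurableSet_Ioi] with x hx
      have h1 : (0:ℝ) < ε := hε
      have h2 : (0:ℝ) < x := hx
      rw [norm_mul, Complex.norm_exp]
      refine mul_le_of_le_one_left (norm_nonneg _) ?_
      rw [Real.exp_le_one_iff, Complex.re_mul_ofReal]
      simp only [Complex.neg_re, Complex.ofReal_re]
      nlinarith [mul_pos h1 h2]
    · refine Eventually.of_forall fun x => ?_
      have : Continuous fun ε : ℝ => Complex.exp (-ε * x) * hhP f x := by fun_prop
      have := this.tendsto 0
      simp only [Complex.ofReal_zero, neg_zero, zero_mul, Complex.exp_zero, one_mul] at this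
      exact this.mono_left nhdsWithin_le_nhds
  have h3 : ∫ x in Ioi (0:ℝ), hhP f x =
      (-Complex.I)⁻¹ * ∫ p : ℝ × ℝ, hhT f p * ((p.1 + p.2 : ℝ) : ℂ)⁻¹ := by
    refine tendsto_nhds_unique h2 (h.congr' ?_)
    filter_upwards [self_mem_nhdsWithin] with ε hε
    rw [← hh_fubini hf (w := Complex.I) (by simp) hε]
    congr 1 with x
    rw [hhL_I hf, hhL_I hf.conj, hhC_conj, hhS_conj, hhP]
  have h4 : ∫ x in Ioi (0:ℝ), (hhP f x).im = (∫ x in Ioi (0:ℝ), hhP f x).im := by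
    simpa using integral_im (𝕜 := ℂ) (hhP_int hf).integrableOn
  rw [h4, h3]
  simpa using hh_carleman hf

theorem hh_main {f : ℝ → ℂ} (hf : HHNice f) :
    Integrable (fun x => ‖hhC f x + hhS f x‖ ^ 2) ∧
    π * ∫ t, ‖f t‖ ^ 2 ≤ ∫ x in Ioi (0:ℝ), ‖hhC f x + hhS f x‖ ^ 2 ∧
    ∫ x in Ioi (0:ℝ), ‖hhC f x + hhS f x‖ ^ 2 ≤ 2 * π * ∫ t, ‖f t‖ ^ 2 := by
  obtain ⟨hG, hGv⟩ := hhG_int hf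
  have hPi : Integrable (fun x => (hhP f x).im) := (hhP_int hf).im
  have hI : Integrable (fun x => ‖hhC f x + hhS f x‖ ^ 2) := by
    simp_rw [hhP_im]
    exact hG.add hPi
  refine ⟨hI, ?_, ?_⟩
  · simp_rw [hhP_im]
    rw [integral_add hG.integrableOn hPi.integrableOn, hGv]
    linarith [hhP_nonneg hf]
  · have : ∫ x in Ioi (0:ℝ), ‖hhC f x + hhS f x‖ ^ 2 ≤ ∫ x in Ioi (0:ℝ), 2 * hhG f x := by
      refine integral_mono hI.integrableOn (hG.const_mul 2).integrableOn fun x => ?_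
      have h1 := norm_add_le (hhC f x) (hhS f x)
      simp only [hhG]
      nlinarith [sq_nonneg (‖hhC f x‖ - ‖hhS f x‖), norm_nonneg (hhC f x + hhS f x)]
    rw [integral_const_mul, hGv] at this
    linarith

theorem HHNice.eq_zero {f : ℝ → ℂ} (hf : HHNice f) {t : ℝ} (ht : t ∉ Ioi (0:ℝ)) : f t = 0 := by
  by_contra h
  exact ht (hf.supp (subset_tsupport f h))

theorem hh_eq {f : ℝ → ℂ} (hf : HHNice f) (x : ℝ) :
    halfHartley f x = (Real.sqrt (2 / π) : ℂ) * (hhC f x + hhS f x) := by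
  rw [halfHartley, setIntegral_eq_integral_of_forall_compl_eq_zero
    (fun t ht => by rw [hf.eq_zero ht, mul_zero]), hhC, hhS,
    ← integral_add (hh_cint hf x) (hh_sint hf x)]
  congr 2 with t
  push_cast
  ring

theorem hh_int {f : ℝ → ℂ} (hf : HHNice f) : ∫ t, ‖f t‖ ^ 2 = ∫ t in Ioi (0:ℝ), ‖f t‖ ^ 2 := by
  rw [setIntegral_eq_integral_of_forall_compl_eq_zero
    (fun t ht => by rw [hf.eq_zero ht]; simp)]

theorem hh_norm {f : ℝ → ℂ} (hf : HHNice f) :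
    MemLp (halfHartley f) 2 (volume.restrict (Ioi (0:ℝ))) ∧
    2 * ∫ t in Ioi (0:ℝ), ‖f t‖ ^ 2 ≤ ∫ x in Ioi (0:ℝ), ‖halfHartley f x‖ ^ 2 ∧
    ∫ x in Ioi (0:ℝ), ‖halfHartley f x‖ ^ 2 ≤ 4 * ∫ t in Ioi (0:ℝ), ‖f t‖ ^ 2 := by
  obtain ⟨h1, h2, h3⟩ := hh_main hf
  have hC := hhC_cont hf
  have hS := hhS_cont hf
  have e : halfHartley f = fun x => (Real.sqrt (2 / π) : ℂ) * (hhC f x + hhS f x) :=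
    funext (hh_eq hf)
  have e2 : ∀ x, ‖halfHartley f x‖ ^ 2 = 2 / π * ‖hhC f x + hhS f x‖ ^ 2 := by
    intro x
    rw [hh_eq hf, norm_mul, mul_pow, Complex.norm_real, Real.norm_eq_abs, sq_abs,
      Real.sq_sqrt (by positivity)]
  have e3 : ∫ x in Ioi (0:ℝ), ‖halfHartley f x‖ ^ 2 =
      2 / π * ∫ x in Ioi (0:ℝ), ‖hhC f x + hhS f x‖ ^ 2 := by
    simp_rw [e2]
    rw [integral_const_mul]
  rw [hh_int hf] at h2 h3
  refine ⟨?_, ?_, ?_⟩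
  · rw [memLp_two_iff_integrable_sq_norm]
    · simp_rw [e2]
      exact (h1.const_mul _).integrableOn
    · rw [e]
      exact Continuous.aestronglyMeasurable (by fun_prop)
  · rw [e3]
    calc 2 * ∫ t in Ioi (0:ℝ), ‖f t‖ ^ 2 = 2 / π * (π * ∫ t in Ioi (0:ℝ), ‖f t‖ ^ 2) := by
          field_simp
      _ ≤ _ := by gcongr
  · rw [e3]
    calc _ ≤ 2 / π * (2 * π * ∫ t in Ioi (0:ℝ), ‖f t‖ ^ 2) := by gcongr
      _ = _ := by field_simp; ring

/-- The space of test functions. -/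
def hhW : Submodule ℂ (ℝ → ℂ) where
  carrier := {f | HHNice f}
  add_mem' := by
    intro f g hf hg
    refine ⟨hf.smooth.add hg.smooth, hf.cpt.add hg.cpt, ?_⟩
    exact (tsupport_add f g).trans (union_subset hf.supp hg.supp)
  zero_mem' := ⟨contDiff_const, HasCompactSupport.zero, by simp [tsupport]⟩
  smul_mem' := by
    intro c f hf
    exact ⟨hf.smooth.const_smul c, hf.cpt.smul_left (f := fun _ => c),
      (tsupport_smul_subset_right (fun _ => c) f).trans hf.supp⟩

/-- The half-line measure. -/
noncomputable abbrev hhμ : Measure ℝ := volume.restrict (Ioi (0 : ℝ))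

theorem HHNice.memLp {f : ℝ → ℂ} (hf : HHNice f) : MemLp f 2 hhμ :=
  (hf.smooth.continuous.memLp_of_hasCompactSupport hf.cpt).restrict _

theorem hhW_nice (f : hhW) : HHNice (f : ℝ → ℂ) := f.2

theorem hh_add {f g : ℝ → ℂ} (hf : HHNice f) (hg : HHNice g) :
    halfHartley (f + g) = halfHartley f + halfHartley g := by
  ext x
  rw [hh_eq (hhW.add_mem hf hg : HHNice (f + g)), Pi.add_apply, hh_eq hf, hh_eq hg]
  simp only [hhC, hhS, Pi.add_apply, mul_add]
  rw [integral_add (hh_cint hf x) (hh_cint hg x), integral_add (hh_sint hf x) (hh_sint hg x)]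
  ring

theorem hh_smul {f : ℝ → ℂ} (c : ℂ) : halfHartley (c • f) = c • halfHartley f := by
  ext x
  simp only [halfHartley, Pi.smul_apply, smul_eq_mul]
  rw [mul_left_comm]
  congr 1
  rw [← integral_const_mul]
  congr 1 with t
  ring

/-- Inclusion of test functions. -/
noncomputable def hhE : hhW →ₗ[ℂ] Lp ℂ 2 hhμ where
  toFun f := (hhW_nice f).memLp.toLp f
  map_add' _ _ := rfl
  map_smul' _ _ := rfl

/-- The transform on test functions. -/
noncomputable def hhA : hhW →ₗ[ℂ] Lp ℂ 2 hhμ where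
  toFun f := (hh_norm (hhW_nice f)).1.toLp (halfHartley f)
  map_add' f g := by
    rw [← MemLp.toLp_add]
    congr 1
    exact hh_add (hhW_nice f) (hhW_nice g)
  map_smul' c f := by
    rw [RingHom.id_apply, ← MemLp.toLp_const_smul]
    congr 1
    exact hh_smul c

theorem hh_toLp_norm {f : ℝ → ℂ} (hf : MemLp f 2 hhμ) :
    ‖hf.toLp f‖ ^ 2 = ∫ x in Ioi (0:ℝ), ‖f x‖ ^ 2 := by
  rw [@norm_sq_eq_re_inner ℂ, L2.inner_def]
  have : ∀ᵐ x ∂hhμ, inner ℂ (hf.toLp f x) (hf.toLp f x) = ((‖f x‖ ^ 2 : ℝ) : ℂ) := by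
    filter_upwards [hf.coeFn_toLp] with x hx
    rw [hx, inner_self_eq_norm_sq_to_K]
    simp
  rw [integral_congr_ae this, integral_complex_ofReal]
  simp

theorem hhA_le (f : hhW) : ‖hhA f‖ ≤ 2 * ‖hhE f‖ := by
  have h := (hh_norm (hhW_nice f)).2.2
  rw [← hh_toLp_norm (hhW_nice f).memLp, ← hh_toLp_norm (hh_norm (hhW_nice f)).1] at h
  change ‖hhA f‖ ^ 2 ≤ 4 * ‖hhE f‖ ^ 2 at h
  refine abs_le_of_sq_le_sq' ?_ (by positivity) |>.2
  linarith

theorem hhA_ge (f : hhW) : Real.sqrt 2 * ‖hhE f‖ ≤ ‖hhA f‖ := by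
  have h := (hh_norm (hhW_nice f)).2.1
  rw [← hh_toLp_norm (hhW_nice f).memLp, ← hh_toLp_norm (hh_norm (hhW_nice f)).1] at h
  change 2 * ‖hhE f‖ ^ 2 ≤ ‖hhA f‖ ^ 2 at h
  refine abs_le_of_sq_le_sq' ?_ (by positivity) |>.2
  rw [mul_pow, Real.sq_sqrt (by norm_num)]
  exact h

theorem hhE_dense : DenseRange hhE := by
  have hd : Dense ((LinearMap.range hhE : Submodule ℂ (Lp ℂ 2 hhμ)) : Set (Lp ℂ 2 hhμ)) := by
    rw [Submodule.dense_iff_topologicalClosure_eq_top, Submodule.topologicalClosure_eq_top_iff,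
      Submodule.eq_bot_iff]
    intro u hu
    rw [Submodule.mem_orthogonal] at hu
    have hloc : LocallyIntegrableOn (u : ℝ → ℂ) (Ioi 0) volume := by
      have h1 : LocallyIntegrable (u : ℝ → ℂ) hhμ := (Lp.memLp u).locallyIntegrable (by norm_num)
      exact locallyIntegrableOn_of_locallyIntegrable_restrict h1
    have h0 : ∀ᵐ x ∂volume, x ∈ Ioi (0:ℝ) → (u : ℝ → ℂ) x = 0 := by
      refine isOpen_Ioi.ae_eq_zero_of_integral_contDiff_smul_eq_zero hloc ?_
      intro g hg hgc hgs
      have hn : HHNice (fun t => (g t : ℂ)) :=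
        { smooth := Complex.ofRealCLM.contDiff.comp (contDiff_infty.1 hg 2)
          cpt := hgc.comp_left (g := fun r : ℝ => (r : ℂ)) (by simp)
          supp := (closure_mono (Function.support_comp_subset (g := fun r : ℝ => (r : ℂ))
            (by simp) g)).trans hgs }
      have hu' := hu (hhE ⟨_, hn⟩) (LinearMap.mem_range_self _ _)
      rw [L2.inner_def] at hu'
      have : ∀ᵐ x ∂hhμ, inner ℂ (hhE ⟨_, hn⟩ x) (u x) = g x • u x := by
        filter_upwards [hn.memLp.coeFn_toLp] with x hx
        change inner ℂ (hn.memLp.toLp _ x) (u x) = _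
        rw [hx]
        simp [mul_comm]
      rw [integral_congr_ae this, setIntegral_eq_integral_of_forall_compl_eq_zero] at hu'
      · exact hu'
      · intro x hx
        have : g x = 0 := by
          by_contra h
          exact hx (hgs (subset_tsupport g h))
        simp [this]
    rw [Lp.eq_zero_iff_ae_eq_zero]
    exact (ae_restrict_iff' measurableSet_Ioi).2 h0
  exact hd

theorem hhA_symm (f g : hhW) : inner ℂ (hhA f) (hhE g) = inner ℂ (hhE f) (hhA g) := by
  have hf := hhW_nice f
  have hg := hhW_nice g
  have e1 : inner ℂ (hhA f) (hhE g) = ∫ x in Ioi (0:ℝ), ∫ t in Ioi (0:ℝ),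
      (Real.sqrt (2 / π) : ℂ) * (((Real.cos (x * t) + Real.sin (x * t) : ℝ) : ℂ) *
        (conj ((f : ℝ → ℂ) t) * (g : ℝ → ℂ) x)) := by
    rw [L2.inner_def]
    refine integral_congr_ae ?_
    filter_upwards [hg.memLp.coeFn_toLp, (hh_norm hf).1.coeFn_toLp] with x h1 h2
    change inner ℂ ((hh_norm hf).1.toLp _ x) (hg.memLp.toLp _ x) = _
    rw [h1, h2, RCLike.inner_apply, halfHartley, map_mul, Complex.conj_ofReal, ← integral_conj,
      integral_const_mul, mul_left_comm, ← integral_const_mul]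
    congr 2 with t
    rw [map_mul, Complex.conj_ofReal]
    ring
  have e2 : inner ℂ (hhE f) (hhA g) = ∫ t in Ioi (0:ℝ), ∫ x in Ioi (0:ℝ),
      (Real.sqrt (2 / π) : ℂ) * (((Real.cos (x * t) + Real.sin (x * t) : ℝ) : ℂ) *
        (conj ((f : ℝ → ℂ) t) * (g : ℝ → ℂ) x)) := by
    rw [L2.inner_def]
    refine integral_congr_ae ?_
    filter_upwards [hf.memLp.coeFn_toLp, (hh_norm hg).1.coeFn_toLp] with t h1 h2
    change inner ℂ (hf.memLp.toLp _ t) ((hh_norm hg).1.toLp _ t) = _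
    rw [h1, h2, RCLike.inner_apply, halfHartley,
      integral_const_mul, mul_assoc, ← integral_mul_const]
    congr 2 with x
    rw [mul_comm t x]
    ring
  rw [e1, e2]
  refine integral_integral_swap (Integrable.const_mul ?_ _)
  have hi : Integrable (fun q : ℝ × ℝ => conj ((f : ℝ → ℂ) q.2) * (g : ℝ → ℂ) q.1)
      (hhμ.prod hhμ) := by
    have := hg.integrable.integrableOn (s := Ioi 0) |>.mul_prod
      (hf.conj.integrable.integrableOn (s := Ioi 0))
    refine this.congr (Eventually.of_forall fun q => ?_)
    simp only [mul_comm]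
  refine hi.bdd_mul (c := 2) (Continuous.aestronglyMeasurable (by fun_prop))
    (Eventually.of_forall fun q => ?_)
  rw [Complex.norm_real]
  refine (norm_add_le _ _).trans ?_
  have h1 := Real.abs_cos_le_one (q.1 * q.2)
  have h2 := Real.abs_sin_le_one (q.1 * q.2)
  rw [Real.norm_eq_abs, Real.norm_eq_abs]
  linarith

/-- There is a bounded linear operator on `L²(0,∞)` extending the half-Hartley transform,
satisfying the two-sided norm bounds `√2 ‖f‖ ≤ ‖Tf‖ ≤ 2 ‖f‖`, and which is a bijection
of `L²(0,∞)` onto itself. -/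
theorem halfHartley_L2_extension :
    ∃ T : Lp ℂ 2 (volume.restrict (Ioi (0 : ℝ))) →L[ℂ] Lp ℂ 2 (volume.restrict (Ioi (0 : ℝ))),
      (∀ (f : ℝ → ℂ), ContDiff ℝ 2 f → HasCompactSupport f → tsupport f ⊆ Ioi (0 : ℝ) →
        ∀ (hf : MemLp f 2 (volume.restrict (Ioi (0 : ℝ)))),
          T (hf.toLp f) =ᵐ[volume.restrict (Ioi (0 : ℝ))] halfHartley f) ∧
      (∀ u : Lp ℂ 2 (volume.restrict (Ioi (0 : ℝ))),
        Real.sqrt 2 * ‖u‖ ≤ ‖T u‖ ∧ ‖T u‖ ≤ 2 * ‖u‖) ∧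
      Function.Bijective T := by
  let T : Lp ℂ 2 hhμ →L[ℂ] Lp ℂ 2 hhμ := hhA.extendOfNorm hhE
  have hT : ∀ f, T (hhE f) = hhA f := fun f =>
    LinearMap.extendOfNorm_eq hhE_dense ⟨2, hhA_le⟩ f
  have hup : ∀ u, ‖T u‖ ≤ 2 * ‖u‖ := LinearMap.norm_extendOfNorm_apply_le hhE_dense 2 hhA_le
  have hlow : ∀ u, Real.sqrt 2 * ‖u‖ ≤ ‖T u‖ := by
    intro u
    refine hhE_dense.induction_on (p := fun u => Real.sqrt 2 * ‖u‖ ≤ ‖T u‖) u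
      (isClosed_le (by fun_prop) (by fun_prop)) fun f => ?_
    rw [hT]
    exact hhA_ge f
  have hsymm : ∀ u v, inner ℂ (T u) v = inner ℂ u (T v) := by
    intro u v
    refine hhE_dense.induction_on₂ (p := fun u v => inner ℂ (T u) v = inner ℂ u (T v))
      (isClosed_eq (by fun_prop) (by fun_prop)) (fun f g => ?_) u v
    rw [hT, hT]
    exact hhA_symm f g
  have hs2 : (0:ℝ) < Real.sqrt 2 := by positivity
  have hker : ∀ u, T u = 0 → u = 0 := by
    intro u hu
    have := hlow u
    rw [hu, norm_zero] at this
    have h0 : ‖u‖ ≤ 0 := by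
      by_contra h
      push Not at h
      nlinarith [mul_pos hs2 h]
    exact norm_le_zero_iff.1 h0
  refine ⟨T, ?_, fun u => ⟨hlow u, hup u⟩, ?_, ?_⟩
  · intro f h1 h2 h3 hf
    have hn : HHNice f := ⟨h1, h2, h3⟩
    have e : T (hf.toLp f) = (hh_norm hn).1.toLp (halfHartley f) := hT ⟨f, hn⟩
    rw [e]
    exact (hh_norm hn).1.coeFn_toLp
  · exact (injective_iff_map_eq_zero T).2 hker
  · have hanti : AntilipschitzWith (Real.toNNReal (Real.sqrt 2)⁻¹) T := by
      refine AddMonoidHomClass.antilipschitz_of_bound T fun u => ?_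
      rw [Real.coe_toNNReal _ (by positivity), inv_mul_eq_div, le_div_iff₀ hs2, mul_comm]
      exact hlow u
    have hcl : IsClosed ((LinearMap.range (T : Lp ℂ 2 hhμ →ₗ[ℂ] Lp ℂ 2 hhμ)) : Set (Lp ℂ 2 hhμ)) := by
      have := hanti.isClosed_range T.uniformContinuous
      simpa using! this
    have htop : LinearMap.range (T : Lp ℂ 2 hhμ →ₗ[ℂ] Lp ℂ 2 hhμ) = ⊤ := by
      rw [← hcl.submodule_topologicalClosure_eq, Submodule.topologicalClosure_eq_top_iff,
        Submodule.eq_bot_iff]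
      intro u hu
      rw [Submodule.mem_orthogonal] at hu
      apply hker
      have := hu (T (T u)) ⟨T u, rfl⟩
      rw [hsymm] at this
      exact inner_self_eq_zero.1 this
    intro v
    have hv : v ∈ LinearMap.range (T : Lp ℂ 2 hhμ →ₗ[ℂ] Lp ℂ 2 hhμ) := htop ▸ Submodule.mem_top
    exact hv
end

section
/- For all real τ and θ, the estimate 2 · (|Γ(1/2 + iτ)| · |Γ(1/2 + iθ)| / |Γ(1/2 + i(τ + θ))|) · (cosh(πτ/2) cosh(πθ/2) / cosh(π(τ + θ)/2)) ≤ 4√(2π) holds, where Γ denotes the complex Gamma function. -/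
open MeasureTheory Set Filter
open scoped Real

/-- `|Γ(1/2+it)|² cosh(πt) = π`. -/
lemma norm_gamma_half_sq (t : ℝ) :
    ‖Complex.Gamma (1 / 2 + t * Complex.I)‖ ^ 2 * Real.cosh (π * t) = π := by
  have h := Complex.Gamma_mul_Gamma_one_sub (1 / 2 + t * Complex.I)
  have hc : (1 : ℂ) - (1 / 2 + t * Complex.I)
      = (starRingEnd ℂ) (1 / 2 + t * Complex.I) := by
    apply Complex.ext
    · simp; norm_num
    · simp
  have hs : Complex.sin (π * (1 / 2 + t * Complex.I)) = ((Real.cosh (π * t) : ℝ) : ℂ) := by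
    have e : (π : ℂ) * (1 / 2 + t * Complex.I)
        = ((π * t : ℝ) : ℂ) * Complex.I + π / 2 := by push_cast; ring
    rw [e, Complex.sin_add_pi_div_two, Complex.cos_mul_I, Complex.ofReal_cosh]
  rw [hc, Complex.Gamma_conj, Complex.mul_conj, hs, Complex.normSq_eq_norm_sq] at h
  have h2 : ‖Complex.Gamma (1 / 2 + t * Complex.I)‖ ^ 2 = π / Real.cosh (π * t) := by
    exact_mod_cast h
  rw [h2]
  exact div_mul_cancel₀ _ (Real.cosh_pos _).ne'

/-- Two-sided bound for `|Γ(1/2+it)| cosh(πt/2)`. -/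
lemma gamma_cosh_bounds (t : ℝ) :
    π / 2 ≤ (‖Complex.Gamma (1 / 2 + t * Complex.I)‖ * Real.cosh (π * t / 2)) ^ 2 ∧
    (‖Complex.Gamma (1 / 2 + t * Complex.I)‖ * Real.cosh (π * t / 2)) ^ 2 ≤ π := by
  have h := norm_gamma_half_sq t
  have e : Real.cosh (π * t) = 2 * Real.cosh (π * t / 2) ^ 2 - 1 := by
    have := Real.cosh_two_mul (π * t / 2)
    rw [Real.sinh_sq, show 2 * (π * t / 2) = π * t by ring] at this
    linarith
  rw [e] at h
  have h1 := Real.one_le_cosh (π * t / 2)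
  have hg := sq_nonneg ‖Complex.Gamma (1 / 2 + t * Complex.I)‖
  rw [mul_pow]
  constructor
  · nlinarith
  · nlinarith [mul_nonneg hg (show 0 ≤ Real.cosh (π * t / 2) ^ 2 - 1 by nlinarith)]

/-- Uniform bound on the modulus of the Mellin–Barnes convolution kernel on the critical
lines `s = 1/2 + iτ`, `w = 1/2 + iθ`. -/
theorem mellin_barnes_kernel_bound (τ θ : ℝ) :
    2 * (‖Complex.Gamma (1 / 2 + τ * Complex.I)‖ *
          ‖Complex.Gamma (1 / 2 + θ * Complex.I)‖ /
          ‖Complex.Gamma (1 / 2 + (τ + θ) * Complex.I)‖) *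
        (Real.cosh (π * τ / 2) * Real.cosh (π * θ / 2) / Real.cosh (π * (τ + θ) / 2)) ≤
      4 * Real.sqrt (2 * π) := by
  have hA := (gamma_cosh_bounds τ).2
  have hB := (gamma_cosh_bounds θ).2
  have hC := (gamma_cosh_bounds (τ + θ)).1
  rw [Complex.ofReal_add] at hC
  have hpi := Real.pi_pos
  have e : ∀ a b c x y z : ℝ, 2 * (a * b / c) * (x * y / z) = 2 * ((a * x) * (b * y) / (c * z)) := by
    intro a b c x y z
    rw [mul_assoc, div_mul_div_comm]
    congr 2
    ring
  rw [e]
  have hC0 : 0 ≤ ‖Complex.Gamma (1 / 2 + (τ + θ) * Complex.I)‖ *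
      Real.cosh (π * (τ + θ) / 2) := mul_nonneg (norm_nonneg _) (Real.cosh_pos _).le
  generalize ‖Complex.Gamma (1 / 2 + τ * Complex.I)‖ * Real.cosh (π * τ / 2) = A at *
  generalize ‖Complex.Gamma (1 / 2 + θ * Complex.I)‖ * Real.cosh (π * θ / 2) = B at *
  generalize ‖Complex.Gamma (1 / 2 + (τ + θ) * Complex.I)‖ *
      Real.cosh (π * (τ + θ) / 2) = C at *
  have hCp : 0 < C := by
    rcases hC0.eq_or_lt with h | h
    · rw [← h] at hC
      norm_num at hC
      linarith
    · exact h
  have hAB : A * B ≤ π := by nlinarith [sq_nonneg (A - B)]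
  have hS := Real.sq_sqrt (show 0 ≤ 2 * π by positivity)
  have hS0 := Real.sqrt_nonneg (2 * π)
  have hSC : π ≤ Real.sqrt (2 * π) * C := by
    refine (pow_le_pow_iff_left₀ hpi.le (by positivity) two_ne_zero).1 ?_
    rw [mul_pow, hS]
    nlinarith
  have : A * B / C ≤ Real.sqrt (2 * π) := by
    rw [div_le_iff₀ hCp]
    linarith
  linarith
end

section
/- Existence and norm estimate for the Mellin–Barnes convolution: let f, g ∈ L²(0,∞) be such that their Mellin transforms f*(s) = ∫₀^∞ f(t)t^{s−1}dt and g*(s) = ∫₀^∞ g(t)t^{s−1}dt converge absolutely for every s on the critical line Re s = 1/2, and suppose ∫_{-∞}^{∞} |(1/2 + iτ) f*(1/2 + iτ)|² dτ < ∞ and ∫_{-∞}^{∞} |(1/2 + iθ) g*(1/2 + iθ)|² dθ < ∞. Then the double integral (f ⋆ g)(x) = (2π)^{-2} ∫_{-∞}^{∞} ∫_{-∞}^{∞} [Γ(s)Γ(w)/Γ(s + w − 1/2)] · [(sin(π(s+w)/2) + cos(π(s−w)/2))/sin(π(s+w)/2)] f*(1−s) g*(1−w) x^{s+w−3/2} dτ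 dθ (with s = 1/2 + iτ, w = 1/2 + iθ) converges absolutely for every x > 0, the resulting function belongs to L²(0,∞), and ‖f ⋆ g‖_{L²(0,∞)} ≤ 4√(2/π) (∫_{-∞}^{∞} |(1/2 + iθ) g*(1/2 + iθ)|² dθ)^{1/2} (∫_{-∞}^{∞} |(1/2 + iτ) f*(1/2 + iτ)|² dτ)^{1/2}. -/
open MeasureTheory Set Filter
open scoped Real

/-- The Mellin–Barnes convolution kernel
`Γ(s)Γ(w)/Γ(s+w-1/2) · [sin(π(s+w)/2) + cos(π(s-w)/2)]/sin(π(s+w)/2)`. -/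
noncomputable def mbKernel (s w : ℂ) : ℂ :=
  Complex.Gamma s * Complex.Gamma w / Complex.Gamma (s + w - 1 / 2) *
    ((Complex.sin (π * (s + w) / 2) + Complex.cos (π * (s - w) / 2)) /
      Complex.sin (π * (s + w) / 2))

/-- The integrand of the Mellin–Barnes convolution of `f` and `g` at the point `x`,
parametrized by `(τ, θ)` with `s = 1/2 + iτ`, `w = 1/2 + iθ`. -/
noncomputable def mbConvIntegrand (f g : ℝ → ℂ) (x : ℝ) (p : ℝ × ℝ) : ℂ :=
  mbKernel (1 / 2 + p.1 * Complex.I) (1 / 2 + p.2 * Complex.I) *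
    mellin f (1 - (1 / 2 + p.1 * Complex.I)) * mellin g (1 - (1 / 2 + p.2 * Complex.I)) *
    (x : ℂ) ^ ((1 / 2 + p.1 * Complex.I) + (1 / 2 + p.2 * Complex.I) - 3 / 2)

/-- The Mellin–Barnes convolution of `f` and `g`, related to the half-Hartley transform. -/
noncomputable def mbConv (f g : ℝ → ℂ) (x : ℝ) : ℂ :=
  ((((2 * π) ^ 2)⁻¹ : ℝ) : ℂ) * ∫ p : ℝ × ℝ, mbConvIntegrand f g x p


theorem aux_fourier_continuous {h : ℝ → ℂ} (h1 : Integrable h) :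
    Continuous (FourierTransform.fourier h) :=
  VectorFourier.fourierIntegral_continuous Real.continuous_fourierChar
    (innerSL ℝ).continuous₂ h1

theorem aux_plancherel {h : ℝ → ℂ} (h1 : Integrable h) (h2 : MemLp h 2) :
    eLpNorm (FourierTransform.fourier h) 2 = eLpNorm h 2 := by
  set L : Lp ℂ 2 (volume : Measure ℝ) := h2.toLp h with hL
  have key : ∀ᵐ x, FourierTransform.fourier h x = (FourierTransform.fourier L : Lp ℂ 2 (volume : Measure ℝ)) x := by
    apply ae_eq_of_integral_contDiff_smul_eq
    · exact (aux_fourier_continuous h1).locallyIntegrable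
    · exact (Lp.memLp _).locallyIntegrable (by norm_num)
    intro g hg hgc
    have hg1 : HasCompactSupport (fun x => (g x : ℂ)) := hgc.comp_left Complex.ofReal_zero
    have hg2 : ContDiff ℝ ((⊤ : ℕ∞) : WithTop ℕ∞) (fun x => (g x : ℂ)) :=
      Complex.ofRealCLM.contDiff.comp hg
    set G : SchwartzMap ℝ ℂ := hg1.toSchwartzMap hg2 with hG
    have e1 := congrArg (fun T : TemperedDistribution ℝ ℂ => T G) (Lp.fourier_toTemperedDistribution_eq L)
    simp only [TemperedDistribution.fourier_apply, Lp.toTemperedDistribution_apply] at e1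
    have e2 : ∫ x, (FourierTransform.fourier G) x • L x = ∫ x, (FourierTransform.fourier G) x • h x := by
      apply integral_congr_ae
      filter_upwards [h2.coeFn_toLp] with x hx
      rw [hL, hx]
    have e3 : ∫ x, (FourierTransform.fourier G) x • h x = ∫ x, G x • FourierTransform.fourier h x := by
      have := VectorFourier.integral_fourierIntegral_smul_eq_flip (L := innerₗ ℝ)
        (μ := volume) (ν := volume) Real.continuous_fourierChar (by exact continuous_inner) G.integrable h1
      rw [flip_innerₗ] at this
      rw [SchwartzMap.fourier_coe]
      exact this
    have e4 : ∀ x, G x = (g x : ℂ) := fun x => rfl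
    rw [e2, e3] at e1
    simp only [e4] at e1
    simpa using e1
  rw [eLpNorm_congr_ae key]
  have := Lp.norm_fourier_eq L
  rw [Lp.norm_def, hL, Lp.norm_toLp] at this
  exact (ENNReal.toReal_eq_toReal_iff' (Lp.eLpNorm_ne_top _) h2.eLpNorm_ne_top).1 this

theorem aux_conv (a b : ℝ → ENNReal) (ha : Measurable a) (hb : Measurable b) :
    ∫⁻ u, (∫⁻ t, a t * b (u - t)) ^ 2 ≤ (∫⁻ t, a t) ^ 2 * ∫⁻ t, b t ^ 2 := by
  have cs : ∀ u, (∫⁻ t, a t * b (u - t)) ^ 2 ≤ (∫⁻ t, a t) * ∫⁻ t, a t * b (u - t) ^ 2 := by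
    intro u
    have h := ENNReal.lintegral_mul_le_Lp_mul_Lq (volume : Measure ℝ) Real.HolderConjugate.two_two
      (f := fun t => a t ^ (1/2 : ℝ)) (g := fun t => a t ^ (1/2 : ℝ) * b (u - t))
      (by fun_prop) (by fun_prop)
    have e1 : ∀ t, (a t ^ (1/2 : ℝ)) ^ (2:ℝ) = a t := fun t => by
      rw [← ENNReal.rpow_mul]; norm_num
    have e2 : ∀ t, a t ^ (1/2 : ℝ) * (a t ^ (1/2 : ℝ) * b (u - t)) = a t * b (u - t) := fun t => by
      rw [← mul_assoc, ← ENNReal.rpow_add_of_nonneg _ _ (by norm_num) (by norm_num)]; norm_num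
    simp only [Pi.mul_apply, e2, ENNReal.mul_rpow_of_nonneg _ _ (show (0:ℝ) ≤ 2 by norm_num), e1] at h
    rw [← ENNReal.mul_rpow_of_nonneg _ _ (by norm_num)] at h
    have h' := pow_le_pow_left₀ (zero_le) h 2
    refine h'.trans ?_
    rw [← ENNReal.rpow_natCast, ← ENNReal.rpow_mul]
    norm_num
  calc _ ≤ ∫⁻ u, (∫⁻ t, a t) * ∫⁻ t, a t * b (u - t) ^ 2 := lintegral_mono cs
    _ = (∫⁻ t, a t) * ∫⁻ u, ∫⁻ t, a t * b (u - t) ^ 2 := by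
        rw [lintegral_const_mul]
        exact Measurable.lintegral_prod_right' (f := fun p : ℝ × ℝ => a p.2 * b (p.1 - p.2) ^ 2) (by fun_prop)
    _ = (∫⁻ t, a t) * ∫⁻ t, ∫⁻ u, a t * b (u - t) ^ 2 := by
        rw [lintegral_lintegral_swap (by fun_prop)]
    _ = _ := by
        simp only [sq (lintegral _ _), mul_assoc]
        congr 1
        rw [← lintegral_mul_const _ ha]
        congr 1; ext t
        rw [lintegral_const_mul _ (by fun_prop), lintegral_sub_right_eq_self (fun u => b u ^ 2)]

theorem aux_gamma_sq (t : ℝ) : ‖Complex.Gamma (1/2 + t * Complex.I)‖ ^ 2 = π / Real.cosh (π * t) := by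
  have h := Complex.Gamma_mul_Gamma_one_sub (1/2 + t * Complex.I)
  have e : (1 - (1/2 + t * Complex.I)) = (starRingEnd ℂ) (1/2 + t * Complex.I) := by
    apply Complex.ext <;> simp <;> norm_num
  rw [e, Complex.Gamma_conj, Complex.mul_conj] at h
  have e2 : Complex.sin (π * (1/2 + t * Complex.I)) = Real.cosh (π * t) := by
    have : (π : ℂ) * (1/2 + t * Complex.I) = (π * t : ℝ) * Complex.I + π / 2 := by push_cast; ring
    rw [this, Complex.sin_add_pi_div_two, Complex.cos_mul_I]; simp
  rw [e2, Complex.normSq_eq_norm_sq] at h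
  exact_mod_cast h

theorem aux_sin (t u : ℝ) : Complex.sin (π * ((1 / 2 + t * Complex.I) + (1 / 2 + u * Complex.I)) / 2)
    = (Real.cosh (π * t / 2 + π * u / 2) : ℝ) := by
  have : (π : ℂ) * ((1 / 2 + t * Complex.I) + (1 / 2 + u * Complex.I)) / 2
    = ((π * t / 2 + π * u / 2 : ℝ) : ℂ) * Complex.I + π / 2 := by push_cast; ring
  rw [this, Complex.sin_add_pi_div_two, Complex.cos_mul_I]; simp

theorem aux_cos (t u : ℝ) : Complex.cos (π * ((1 / 2 + t * Complex.I) - (1 / 2 + u * Complex.I)) / 2)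
    = (Real.cosh (π * t / 2 - π * u / 2) : ℝ) := by
  have : (π : ℂ) * ((1 / 2 + t * Complex.I) - (1 / 2 + u * Complex.I)) / 2
    = ((π * t / 2 - π * u / 2 : ℝ) : ℂ) * Complex.I := by push_cast; ring
  rw [this, Complex.cos_mul_I]; simp

theorem aux_arg (t u : ℝ) : ((1 / 2 + t * Complex.I) + (1 / 2 + u * Complex.I) - 1 / 2 : ℂ)
    = 1 / 2 + ((t + u : ℝ) : ℂ) * Complex.I := by push_cast; ring

theorem aux_kernel_bound (t u : ℝ) :
    ‖mbKernel (1 / 2 + t * Complex.I) (1 / 2 + u * Complex.I)‖ ^ 2 ≤ 8 * π := by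
  unfold mbKernel
  rw [aux_sin, aux_cos, aux_arg, ← Complex.ofReal_add, ← Complex.ofReal_div, norm_mul, norm_div,
    norm_mul, Complex.norm_real, mul_pow, div_pow, mul_pow, aux_gamma_sq, aux_gamma_sq, aux_gamma_sq,
    Real.norm_eq_abs, sq_abs]
  have hs : Real.cosh (π * t / 2 + π * u / 2) + Real.cosh (π * t / 2 - π * u / 2)
      = 2 * Real.cosh (π * t / 2) * Real.cosh (π * u / 2) := by
    rw [Real.cosh_add, Real.cosh_sub]; ring
  have c2 : ∀ x : ℝ, Real.cosh (2 * x) = 2 * Real.cosh x ^ 2 - 1 := fun x => by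
    rw [Real.cosh_two_mul, Real.sinh_sq]; ring
  have e1 : π * t = 2 * (π * t / 2) := by ring
  have e2 : π * u = 2 * (π * u / 2) := by ring
  have e3 : π * (t + u) = 2 * (π * t / 2 + π * u / 2) := by ring
  rw [hs, e3, e1, e2, c2, c2, c2]
  simp only [mul_div_cancel_left₀ _ (two_ne_zero' ℝ)]
  set A := Real.cosh (π * t / 2) with hA
  set B := Real.cosh (π * u / 2) with hB
  set C := Real.cosh (π * t / 2 + π * u / 2) with hC
  have A1 : 1 ≤ A := Real.one_le_cosh _
  have B1 : 1 ≤ B := Real.one_le_cosh _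
  have C1 : 1 ≤ C := Real.one_le_cosh _
  have pp := Real.pi_pos
  have A2 : A ^ 2 ≤ 2 * A ^ 2 - 1 := by nlinarith
  have B2 : B ^ 2 ≤ 2 * B ^ 2 - 1 := by nlinarith
  have C2 : 0 < 2 * C ^ 2 - 1 := by nlinarith
  have a0 : 0 < 2 * A ^ 2 - 1 := by nlinarith
  have b0 : 0 < 2 * B ^ 2 - 1 := by nlinarith
  have : π / (2 * A ^ 2 - 1) * (π / (2 * B ^ 2 - 1)) / (π / (2 * C ^ 2 - 1)) * (2 * A * B / C) ^ 2
     = 4 * π * ((A ^ 2 / (2 * A ^ 2 - 1)) * (B ^ 2 / (2 * B ^ 2 - 1)) * ((2 * C ^ 2 - 1) / C ^ 2)) := by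
    field_simp
    norm_num
  rw [this]
  have q1 : A ^ 2 / (2 * A ^ 2 - 1) ≤ 1 := (div_le_one a0).2 A2
  have q2 : B ^ 2 / (2 * B ^ 2 - 1) ≤ 1 := (div_le_one b0).2 B2
  have q3 : (2 * C ^ 2 - 1) / C ^ 2 ≤ 2 := by rw [div_le_iff₀ (by positivity)]; linarith
  have q12 : (A ^ 2 / (2 * A ^ 2 - 1)) * (B ^ 2 / (2 * B ^ 2 - 1)) ≤ 1 :=
    mul_le_one₀ q1 (by positivity) q2
  have : (A ^ 2 / (2 * A ^ 2 - 1)) * (B ^ 2 / (2 * B ^ 2 - 1)) * ((2 * C ^ 2 - 1) / C ^ 2) ≤ 1 * 2 :=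
    mul_le_mul q12 q3 (by positivity) (by norm_num)
  nlinarith

theorem aux_gamma_cont : Continuous fun t : ℝ => Complex.Gamma (1/2 + t * Complex.I) := by
  rw [continuous_iff_continuousAt]
  intro t
  have h : ContinuousAt Complex.Gamma (1/2 + t * Complex.I) := by
    apply (Complex.differentiableAt_Gamma _ _).continuousAt
    intro m hm
    have := congrArg Complex.re hm
    simp at this
    have h2 : (0:ℝ) ≤ m := Nat.cast_nonneg m
    norm_num at this
    linarith
  exact ContinuousAt.comp (f := fun t : ℝ => (1/2 + t * Complex.I : ℂ)) h (by fun_prop)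

theorem aux_gamma_ne (t : ℝ) : Complex.Gamma (1/2 + t * Complex.I) ≠ 0 := by
  apply Complex.Gamma_ne_zero_of_re_pos
  simp

theorem aux_kernel_cont : Continuous fun p : ℝ × ℝ =>
    mbKernel (1 / 2 + p.1 * Complex.I) (1 / 2 + p.2 * Complex.I) := by
  unfold mbKernel
  simp only [aux_arg]
  refine Continuous.mul (Continuous.div₀ ?_ ?_ ?_) (Continuous.div₀ ?_ ?_ ?_)
  · exact (aux_gamma_cont.comp continuous_fst).mul (aux_gamma_cont.comp continuous_snd)
  · exact aux_gamma_cont.comp (continuous_fst.add continuous_snd)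
  · intro p; exact aux_gamma_ne _
  · fun_prop
  · fun_prop
  · intro p
    rw [aux_sin]
    exact_mod_cast (Real.cosh_pos _).ne'

theorem aux_mellin_cont {f : ℝ → ℂ} (hfm : ∀ s : ℂ, s.re = 1 / 2 →
      IntegrableOn (fun t : ℝ => (t : ℂ) ^ (s - 1) • f t) (Ioi 0)) :
    Continuous fun τ : ℝ => mellin f (1 / 2 + τ * Complex.I) := by
  unfold mellin
  apply continuous_of_dominated (bound := fun t : ℝ => ‖(t : ℂ) ^ ((1/2 : ℂ) - 1) • f t‖)
  · intro τ
    exact (hfm (1 / 2 + τ * Complex.I) (by simp)).aestronglyMeasurable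
  · intro τ
    filter_upwards [ae_restrict_mem measurableSet_Ioi] with t ht
    rw [norm_smul, norm_smul, Complex.norm_cpow_eq_rpow_re_of_pos ht,
      Complex.norm_cpow_eq_rpow_re_of_pos ht]
    simp
  · exact (hfm (1/2) (by simp)).norm
  · filter_upwards [ae_restrict_mem measurableSet_Ioi] with t ht
    have : (t : ℂ) ≠ 0 := by exact_mod_cast (ne_of_gt ht)
    simp only [smul_eq_mul]
    refine Continuous.mul ?_ continuous_const
    exact Continuous.const_cpow (by fun_prop) (Or.inl this)

/-- Basic estimates for a function `F` with `∫ |(1/2+iτ) F|² < ∞`. -/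
theorem aux_L1 {F : ℝ → ℂ} (hc : Continuous F)
    (hI : Integrable fun τ : ℝ => ‖(1 / 2 + τ * Complex.I) * F τ‖ ^ 2) :
    Integrable F ∧ (∫ τ, ‖F τ‖) ^ 2 ≤ 2 * π * ∫ τ : ℝ, ‖(1 / 2 + τ * Complex.I) * F τ‖ ^ 2 := by
  have hn : ∀ τ : ℝ, ‖(1 / 2 + τ * Complex.I : ℂ)‖ ^ 2 = 1/4 + τ ^ 2 := fun τ => by
    rw [← Complex.normSq_eq_norm_sq, Complex.normSq_apply]; simp; ring
  have hs : ∀ τ : ℝ, (1/4 + τ^2)⁻¹ = 4 * (1 + (2 * τ) ^ 2)⁻¹ := fun τ => by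
    field_simp; ring
  have i1 : Integrable fun τ : ℝ => (1/4 + τ^2)⁻¹ := by
    simp only [hs]
    exact ((integrable_inv_one_add_sq).comp_mul_left' two_ne_zero).const_mul 4
  have v1 : ∫ τ : ℝ, (1/4 + τ^2)⁻¹ = 2 * π := by
    simp only [hs]
    rw [integral_const_mul, Measure.integral_comp_mul_left (fun x : ℝ => (1 + x ^ 2)⁻¹),
      integral_univ_inv_one_add_sq]
    simp; ring
  have hpos : ∀ τ : ℝ, (0:ℝ) < ‖(1 / 2 + τ * Complex.I : ℂ)‖ := fun τ => by
    rw [norm_pos_iff]; intro h; have := congrArg Complex.re h; simp at this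
  have hcs : Continuous fun τ : ℝ => ‖(1 / 2 + τ * Complex.I : ℂ)‖ := by fun_prop
  have m1 : MemLp (fun τ : ℝ => ‖(1 / 2 + τ * Complex.I : ℂ)‖⁻¹) (ENNReal.ofReal 2) := by
    have hci : Continuous fun τ : ℝ => ‖(1 / 2 + τ * Complex.I : ℂ)‖⁻¹ := hcs.inv₀ fun τ => (hpos τ).ne'
    rw [ENNReal.ofReal_ofNat, memLp_two_iff_integrable_sq hci.aestronglyMeasurable]
    simpa only [inv_pow, hn] using i1
  have m2 : MemLp (fun τ : ℝ => ‖(1 / 2 + τ * Complex.I) * F τ‖) (ENNReal.ofReal 2) := by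
    rw [ENNReal.ofReal_ofNat, memLp_two_iff_integrable_sq (Continuous.aestronglyMeasurable (by fun_prop))]
    exact hI
  have hF : ∀ τ : ℝ, ‖(1 / 2 + τ * Complex.I : ℂ)‖⁻¹ * ‖(1 / 2 + τ * Complex.I) * F τ‖ = ‖F τ‖ := fun τ => by
    rw [norm_mul, inv_mul_cancel_left₀ (hpos τ).ne']
  constructor
  · rw [← integrable_norm_iff hc.aestronglyMeasurable]
    rw [ENNReal.ofReal_ofNat] at m1 m2
    have := MemLp.integrable_mul (p := 2) (q := 2) m1 m2
    refine this.congr (Eventually.of_forall fun τ => ?_)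
    exact hF τ
  · have h := integral_mul_le_Lp_mul_Lq_of_nonneg Real.HolderConjugate.two_two
      (Eventually.of_forall fun τ => by positivity) (Eventually.of_forall fun τ => by positivity) m1 m2
    simp only [hF, Real.rpow_two, inv_pow, hn, v1] at h
    have i0 : 0 ≤ ∫ τ : ℝ, ‖(1 / 2 + τ * Complex.I) * F τ‖ ^ 2 := integral_nonneg fun τ => by positivity
    rw [← Real.sqrt_eq_rpow, ← Real.sqrt_eq_rpow] at h
    have h2 := pow_le_pow_left₀ (integral_nonneg fun τ => norm_nonneg _) h 2
    rwa [mul_pow, Real.sq_sqrt (by positivity), Real.sq_sqrt i0] at h2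

theorem aux_L2 {F : ℝ → ℂ} (hc : Continuous F)
    (hI : Integrable fun τ : ℝ => ‖(1 / 2 + τ * Complex.I) * F τ‖ ^ 2) :
    Integrable (fun τ => ‖F τ‖ ^ 2) ∧
      (∫ τ, ‖F τ‖ ^ 2) ≤ 4 * ∫ τ : ℝ, ‖(1 / 2 + τ * Complex.I) * F τ‖ ^ 2 := by
  have hn : ∀ τ : ℝ, ‖(1 / 2 + τ * Complex.I : ℂ)‖ ^ 2 = 1/4 + τ ^ 2 := fun τ => by
    rw [← Complex.normSq_eq_norm_sq, Complex.normSq_apply]; simp; ring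
  have hle : ∀ τ : ℝ, ‖F τ‖ ^ 2 ≤ 4 * ‖(1 / 2 + τ * Complex.I) * F τ‖ ^ 2 := fun τ => by
    rw [norm_mul, mul_pow, hn]
    nlinarith [mul_nonneg (sq_nonneg τ) (sq_nonneg ‖F τ‖)]
  have i : Integrable (fun τ => ‖F τ‖ ^ 2) := by
    refine (hI.const_mul 4).mono' (Continuous.aestronglyMeasurable (by fun_prop)) ?_
    exact Eventually.of_forall fun τ => by
      rw [Real.norm_of_nonneg (by positivity)]; exact hle τ
  refine ⟨i, ?_⟩
  rw [← integral_const_mul]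
  exact integral_mono i (hI.const_mul 4) hle

theorem aux_eLpNorm_sq {α : Type*} [MeasurableSpace α] (μ : Measure α) (h : α → ℂ) :
    eLpNorm h 2 μ ^ 2 = ∫⁻ x, ‖h x‖ₑ ^ 2 ∂μ := by
  have := eLpNorm_nnreal_pow_eq_lintegral (f := h) (μ := μ) (p := 2) two_ne_zero
  simpa using this

/-- Change of variables `x = exp (-2πv)`. -/
theorem aux_change (Ψ : ℝ → ENNReal) :
    ∫⁻ x in Ioi (0:ℝ), ENNReal.ofReal x⁻¹ * Ψ (-Real.log x / (2 * π))
      = ENNReal.ofReal (2 * π) * ∫⁻ v, Ψ v := by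
  have pp := Real.pi_pos
  have hd : ∀ v ∈ (univ : Set ℝ), HasDerivWithinAt (fun v : ℝ => Real.exp (-(2 * π) * v))
      (Real.exp (-(2 * π) * v) * (-(2 * π))) univ v := by
    intro v _
    have h0 : HasDerivAt (fun v : ℝ => -(2 * π) * v) (-(2 * π)) v := by
      simpa using (hasDerivAt_id v).const_mul (-(2 * π))
    exact h0.exp.hasDerivWithinAt
  have hinj : InjOn (fun v : ℝ => Real.exp (-(2 * π) * v)) univ := by
    intro a _ b _ hab
    have := Real.exp_injective hab
    exact mul_left_cancel₀ (neg_ne_zero.2 (by positivity)) this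
  have him : (fun v : ℝ => Real.exp (-(2 * π) * v)) '' univ = Ioi 0 := by
    ext x
    simp only [image_univ, mem_range, mem_Ioi]
    constructor
    · rintro ⟨v, rfl⟩; exact Real.exp_pos _
    · intro hx
      refine ⟨-Real.log x / (2 * π), ?_⟩
      rw [show -(2 * π) * (-Real.log x / (2 * π)) = Real.log x by field_simp, Real.exp_log hx]
  have h := lintegral_image_eq_lintegral_abs_deriv_mul MeasurableSet.univ hd hinj
    (fun x => ENNReal.ofReal x⁻¹ * Ψ (-Real.log x / (2 * π)))
  rw [him] at h
  rw [h, Measure.restrict_univ, ← lintegral_const_mul' _ _ ENNReal.ofReal_ne_top]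
  congr 1; ext v
  rw [Real.log_exp, ← mul_assoc, ← ENNReal.ofReal_mul (abs_nonneg _)]
  congr 2
  · rw [abs_mul, abs_neg, abs_of_pos (Real.exp_pos _), abs_of_pos (by positivity : 0 < 2 * π)]
    field_simp
  · field_simp

theorem aux_cpow {x : ℝ} (hx : 0 < x) (u : ℝ) :
    (x : ℂ) ^ (-(1/2) + u * Complex.I : ℂ)
      = (x ^ (-(1/2) : ℝ) : ℝ) * Complex.exp (((-2 * π * (u * (-Real.log x / (2 * π))) : ℝ) : ℂ) * Complex.I) := by
  have pp := Real.pi_pos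
  have hx0 : (x : ℂ) ≠ 0 := by exact_mod_cast hx.ne'
  rw [Complex.cpow_add _ _ hx0, Complex.ofReal_cpow hx.le]
  congr 1
  · push_cast; rfl
  · rw [Complex.cpow_def_of_ne_zero hx0, ← Complex.ofReal_log hx.le]
    congr 1
    rw [show -2 * π * (u * (-Real.log x / (2 * π))) = Real.log x * u by field_simp]
    push_cast; ring

theorem aux_main {K : ℝ × ℝ → ℂ} {F G : ℝ → ℂ} {M : ℝ} (hK : Continuous K) (hKM : ∀ p, ‖K p‖ ≤ M)
    (hF : Continuous F) (hG : Continuous G) (hF1 : Integrable F) (hG1 : Integrable G)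
    (hG2 : Integrable fun t => ‖G t‖ ^ 2) (Φ : ℝ → ℂ) (c : ℂ)
    (hΦ : ∀ x, 0 < x → Φ x = c * ∫ p : ℝ × ℝ, K p * F p.1 * G p.2 *
      (x : ℂ) ^ (-(1/2) + ((p.1 + p.2 : ℝ) : ℂ) * Complex.I : ℂ)) :
    AEStronglyMeasurable Φ (volume.restrict (Ioi (0 : ℝ))) ∧
    ∫⁻ x in Ioi (0 : ℝ), ‖Φ x‖ₑ ^ 2 ≤
      ENNReal.ofReal (2 * π * ‖c‖ ^ 2 * M ^ 2 * (∫ t, ‖F t‖) ^ 2 * ∫ t, ‖G t‖ ^ 2) := by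
  have pp := Real.pi_pos
  have M0 : 0 ≤ M := (norm_nonneg _).trans (hKM 0)
  set P : ℝ × ℝ → ℂ := fun p => K p * F p.1 * G p.2 with hPdef
  have hPc : Continuous P := by fun_prop
  have hP : Integrable P := by
    have : Integrable (fun p : ℝ × ℝ => M * (‖F p.1‖ * ‖G p.2‖)) := by
      rw [Measure.volume_eq_prod]
      exact (hF1.norm.mul_prod hG1.norm).const_mul M
    refine this.mono' hPc.aestronglyMeasurable (Eventually.of_forall fun p => ?_)
    simp only [hPdef, norm_mul, mul_assoc]
    exact mul_le_mul_of_nonneg_right (hKM p) (by positivity)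
  have mp : MeasurePreserving (fun z : ℝ × ℝ => (z.2, z.1 - z.2)) := by
    have := measurePreserving_prod_sub_swap (volume : Measure ℝ) (volume : Measure ℝ)
    simpa only [Measure.volume_eq_prod] using this
  set H : ℝ → ℂ := fun u => ∫ t, P (t, u - t) with hH
  have hQ : Integrable (fun z : ℝ × ℝ => P (z.2, z.1 - z.2)) :=
    mp.integrable_comp_of_integrable hP
  have hH1 : Integrable H := by
    rw [Measure.volume_eq_prod] at hQ
    exact hQ.integral_prod_left
  have hHb : ∀ u, ‖H u‖ₑ ≤ ENNReal.ofReal M * ∫⁻ t, ‖F t‖ₑ * ‖G (u - t)‖ₑ := by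
    intro u
    rw [← lintegral_const_mul _ (by fun_prop)]
    refine (enorm_integral_le_lintegral_enorm _).trans (lintegral_mono fun t => ?_)
    simp only [hPdef, enorm_mul, mul_assoc]
    gcongr
    rw [← ofReal_norm]
    exact ENNReal.ofReal_le_ofReal (hKM _)
  have hF1' : ∫⁻ t, ‖F t‖ₑ = ENNReal.ofReal (∫ t, ‖F t‖) :=
    (ofReal_integral_norm_eq_lintegral_enorm hF1).symm
  have hG2' : ∫⁻ t, ‖G t‖ₑ ^ 2 = ENNReal.ofReal (∫ t, ‖G t‖ ^ 2) := by
    rw [ofReal_integral_eq_lintegral_ofReal hG2 (Eventually.of_forall fun t => by positivity)]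
    congr 1; ext t
    rw [ENNReal.ofReal_pow (norm_nonneg _), ofReal_norm]
  have hH2 : ∫⁻ u, ‖H u‖ₑ ^ 2 ≤
      ENNReal.ofReal (M ^ 2 * (∫ t, ‖F t‖) ^ 2 * ∫ t, ‖G t‖ ^ 2) := by
    calc _ ≤ ∫⁻ u, (ENNReal.ofReal M * ∫⁻ t, ‖F t‖ₑ * ‖G (u - t)‖ₑ) ^ 2 :=
          lintegral_mono fun u => pow_le_pow_left₀ zero_le (hHb u) 2
      _ = ENNReal.ofReal M ^ 2 * ∫⁻ u, (∫⁻ t, ‖F t‖ₑ * ‖G (u - t)‖ₑ) ^ 2 := by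
          simp only [mul_pow]
          rw [lintegral_const_mul' _ _ (by simp)]
      _ ≤ ENNReal.ofReal M ^ 2 * ((∫⁻ t, ‖F t‖ₑ) ^ 2 * ∫⁻ t, ‖G t‖ₑ ^ 2) := by
          gcongr
          exact aux_conv (fun t => ‖F t‖ₑ) (fun t => ‖G t‖ₑ) (by fun_prop) (by fun_prop)
      _ = _ := by
          have : 0 ≤ ∫ t, ‖F t‖ := integral_nonneg fun t => norm_nonneg _
          rw [hF1', hG2', mul_assoc, ENNReal.ofReal_mul (by positivity), ENNReal.ofReal_mul (by positivity),
            ENNReal.ofReal_pow M0, ENNReal.ofReal_pow this]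
  have hHm : MemLp H 2 := by
    refine ⟨hH1.aestronglyMeasurable, ?_⟩
    have : eLpNorm H 2 ^ 2 < ⊤ := by
      rw [aux_eLpNorm_sq]; exact hH2.trans_lt ENNReal.ofReal_lt_top
    by_contra hcon
    rw [not_lt, top_le_iff] at hcon
    rw [hcon] at this
    simp at this
  have hpl : ∫⁻ v, ‖FourierTransform.fourier H v‖ₑ ^ 2 = ∫⁻ u, ‖H u‖ₑ ^ 2 := by
    rw [← aux_eLpNorm_sq, ← aux_eLpNorm_sq, aux_plancherel hH1 hHm]
  have hΦ2 : ∀ x, 0 < x → Φ x = c * ((x ^ (-(1/2) : ℝ) : ℝ) * FourierTransform.fourier H (-Real.log x / (2 * π))) := by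
    intro x hx
    rw [hΦ x hx]
    congr 1
    have hx0 : (x : ℂ) ≠ 0 := by exact_mod_cast hx.ne'
    have hEc : Continuous fun p : ℝ × ℝ => (x : ℂ) ^ (-(1/2) + ((p.1 + p.2 : ℝ) : ℂ) * Complex.I : ℂ) :=
      Continuous.const_cpow (by fun_prop) (Or.inl hx0)
    have hPE : Integrable (fun p : ℝ × ℝ => P p * (x : ℂ) ^ (-(1/2) + ((p.1 + p.2 : ℝ) : ℂ) * Complex.I : ℂ)) := by
      refine (hP.norm.mul_const (x ^ (-(1/2) : ℝ))).mono' (hPc.mul hEc).aestronglyMeasurable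
        (Eventually.of_forall fun p => ?_)
      rw [norm_mul, Complex.norm_cpow_eq_rpow_re_of_pos hx]
      simp
    have e1 := integral_map mp.aemeasurable (f := fun p : ℝ × ℝ => P p * (x : ℂ) ^ (-(1/2) + ((p.1 + p.2 : ℝ) : ℂ) * Complex.I : ℂ))
      (by rw [mp.map_eq]; exact hPE.aestronglyMeasurable)
    rw [mp.map_eq] at e1
    have i2 := mp.integrable_comp_of_integrable hPE
    rw [Measure.volume_eq_prod] at i2
    simp only [Function.comp_def] at i2
    change ∫ p, P p * _ = _
    rw [e1, Measure.volume_eq_prod, integral_prod _ i2, Real.fourier_eq', ← integral_const_mul]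
    congr 1; ext u
    simp only [add_sub_cancel]
    rw [integral_mul_const, aux_cpow hx]
    simp only [smul_eq_mul, hH, RCLike.inner_apply, conj_trivial]
    rw [mul_comm u]
    ring
  constructor
  · have hc2 : ContinuousOn (fun x : ℝ => c * ((x ^ (-(1/2) : ℝ) : ℝ) * FourierTransform.fourier H (-Real.log x / (2 * π)))) (Ioi 0) := by
      refine continuousOn_const.mul (ContinuousOn.mul ?_ ?_)
      · refine Complex.continuous_ofReal.comp_continuousOn ?_
        exact continuousOn_id.rpow_const fun x hx => Or.inl (ne_of_gt hx)
      · refine (aux_fourier_continuous hH1).comp_continuousOn ?_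
        exact ((Real.continuousOn_log.mono fun x hx => ne_of_gt hx).neg).div_const _
    refine (hc2.aestronglyMeasurable measurableSet_Ioi).congr ?_
    filter_upwards [ae_restrict_mem measurableSet_Ioi] with x hx
    exact (hΦ2 x hx).symm
  · have : ∫⁻ x in Ioi (0 : ℝ), ‖Φ x‖ₑ ^ 2 = ∫⁻ x in Ioi (0:ℝ), ‖c‖ₑ ^ 2 *
        (ENNReal.ofReal x⁻¹ * ‖FourierTransform.fourier H (-Real.log x / (2 * π))‖ₑ ^ 2) := by
      refine setLIntegral_congr_fun measurableSet_Ioi fun x hx => ?_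
      have hx' : 0 < x := hx
      rw [hΦ2 x hx, enorm_mul, enorm_mul, mul_pow, mul_pow]
      congr 2
      rw [← ofReal_norm, ← ENNReal.ofReal_pow (norm_nonneg _), Complex.norm_real,
        Real.norm_eq_abs, sq_abs, ← Real.rpow_natCast, ← Real.rpow_mul hx'.le]
      norm_num
      rw [Real.rpow_neg_one]
    rw [this, lintegral_const_mul' _ _ (by simp),
      aux_change (fun v => ‖FourierTransform.fourier H v‖ₑ ^ 2), hpl]
    calc _ ≤ ‖c‖ₑ ^ 2 * (ENNReal.ofReal (2 * π) * ENNReal.ofReal (M ^ 2 * (∫ t, ‖F t‖) ^ 2 * ∫ t, ‖G t‖ ^ 2)) := by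
          gcongr
      _ = _ := by
          rw [← ofReal_norm, ← ENNReal.ofReal_pow (norm_nonneg _), ← ENNReal.ofReal_mul (by positivity),
            ← ENNReal.ofReal_mul (by positivity)]
          congr 1; ring

theorem aux_one_sub (t : ℝ) : (1 - (1 / 2 + t * Complex.I) : ℂ) = 1 / 2 + ((-t : ℝ) : ℂ) * Complex.I := by
  push_cast; ring

theorem aux_norm_neg (t : ℝ) :
    ‖(1 / 2 + t * Complex.I : ℂ)‖ = ‖(1 / 2 + ((-t : ℝ) : ℂ) * Complex.I : ℂ)‖ := by
  rw [← Complex.norm_conj]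
  congr 1
  apply Complex.ext <;> simp

theorem aux_reflect (f : ℝ → ℂ) :
    (fun τ : ℝ => ‖(1 / 2 + τ * Complex.I) * mellin f (1 - (1 / 2 + τ * Complex.I))‖ ^ 2)
      = fun τ : ℝ => (fun τ : ℝ => ‖(1 / 2 + τ * Complex.I) * mellin f (1 / 2 + τ * Complex.I)‖ ^ 2) (-τ) := by
  ext τ
  simp only [aux_one_sub]
  rw [norm_mul, aux_norm_neg, ← norm_mul]

theorem aux_kernel_bound' (p : ℝ × ℝ) :
    ‖mbKernel (1 / 2 + p.1 * Complex.I) (1 / 2 + p.2 * Complex.I)‖ ≤ Real.sqrt (8 * π) :=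
  Real.le_sqrt_of_sq_le (aux_kernel_bound p.1 p.2)

theorem aux_integrand (f g : ℝ → ℂ) (x : ℝ) (p : ℝ × ℝ) :
    mbConvIntegrand f g x p = mbKernel (1 / 2 + p.1 * Complex.I) (1 / 2 + p.2 * Complex.I) *
      mellin f (1 - (1 / 2 + p.1 * Complex.I)) * mellin g (1 - (1 / 2 + p.2 * Complex.I)) *
      (x : ℂ) ^ (-(1/2) + ((p.1 + p.2 : ℝ) : ℂ) * Complex.I : ℂ) := by
  unfold mbConvIntegrand
  congr 2
  push_cast; ring

/-- Existence and norm estimate for the Mellin–Barnes convolution: under square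
summability of `s ↦ s f*(s)` and `w ↦ w g*(w)` on the critical line, the convolution
exists (its defining double integral converges absolutely for every `x > 0`), belongs to
`L²(0,∞)`, and satisfies the stated norm estimate. -/
theorem mbConv_exists_and_norm_estimate (f g : ℝ → ℂ)
    (hf2 : MemLp f 2 (volume.restrict (Ioi (0 : ℝ))))
    (hg2 : MemLp g 2 (volume.restrict (Ioi (0 : ℝ))))
    (hfm : ∀ s : ℂ, s.re = 1 / 2 →
      IntegrableOn (fun t : ℝ => (t : ℂ) ^ (s - 1) • f t) (Ioi 0))
    (hgm : ∀ s : ℂ, s.re = 1 / 2 →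
      IntegrableOn (fun t : ℝ => (t : ℂ) ^ (s - 1) • g t) (Ioi 0))
    (hfI : Integrable (fun τ : ℝ =>
      ‖(1 / 2 + τ * Complex.I) * mellin f (1 / 2 + τ * Complex.I)‖ ^ 2))
    (hgI : Integrable (fun θ : ℝ =>
      ‖(1 / 2 + θ * Complex.I) * mellin g (1 / 2 + θ * Complex.I)‖ ^ 2)) :
    (∀ x : ℝ, 0 < x → Integrable (mbConvIntegrand f g x)) ∧
      MemLp (mbConv f g) 2 (volume.restrict (Ioi (0 : ℝ))) ∧
      (∫ x in Ioi (0 : ℝ), ‖mbConv f g x‖ ^ 2) ^ ((1 : ℝ) / 2) ≤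
        4 * Real.sqrt (2 / π) *
          (∫ θ : ℝ, ‖(1 / 2 + θ * Complex.I) * mellin g (1 / 2 + θ * Complex.I)‖ ^ 2) ^
            ((1 : ℝ) / 2) *
          (∫ τ : ℝ, ‖(1 / 2 + τ * Complex.I) * mellin f (1 / 2 + τ * Complex.I)‖ ^ 2) ^
            ((1 : ℝ) / 2) := by
  have pp := Real.pi_pos
  set F : ℝ → ℂ := fun τ => mellin f (1 - (1 / 2 + τ * Complex.I)) with hFdef
  set G : ℝ → ℂ := fun τ => mellin g (1 - (1 / 2 + τ * Complex.I)) with hGdef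
  have hFc : Continuous F := by
    simp only [hFdef, aux_one_sub]
    exact (aux_mellin_cont hfm).comp continuous_neg
  have hGc : Continuous G := by
    simp only [hGdef, aux_one_sub]
    exact (aux_mellin_cont hgm).comp continuous_neg
  have hFI : Integrable fun τ : ℝ => ‖(1 / 2 + τ * Complex.I) * F τ‖ ^ 2 := by
    simp only [hFdef]
    rw [aux_reflect]
    exact hfI.comp_neg
  have hGI : Integrable fun τ : ℝ => ‖(1 / 2 + τ * Complex.I) * G τ‖ ^ 2 := by
    simp only [hGdef]
    rw [aux_reflect]
    exact hgI.comp_neg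
  set A := ∫ τ : ℝ, ‖(1 / 2 + τ * Complex.I) * mellin f (1 / 2 + τ * Complex.I)‖ ^ 2 with hA
  set B := ∫ θ : ℝ, ‖(1 / 2 + θ * Complex.I) * mellin g (1 / 2 + θ * Complex.I)‖ ^ 2 with hB
  have hFA : ∫ τ : ℝ, ‖(1 / 2 + τ * Complex.I) * F τ‖ ^ 2 = A := by
    simp only [hFdef]
    rw [aux_reflect, integral_neg_eq_self
      (fun τ : ℝ => ‖(1 / 2 + τ * Complex.I) * mellin f (1 / 2 + τ * Complex.I)‖ ^ 2)]
  have hGB : ∫ τ : ℝ, ‖(1 / 2 + τ * Complex.I) * G τ‖ ^ 2 = B := by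
    simp only [hGdef]
    rw [aux_reflect, integral_neg_eq_self
      (fun τ : ℝ => ‖(1 / 2 + τ * Complex.I) * mellin g (1 / 2 + τ * Complex.I)‖ ^ 2)]
  have A0 : 0 ≤ A := integral_nonneg fun τ => by positivity
  have B0 : 0 ≤ B := integral_nonneg fun τ => by positivity
  obtain ⟨hF1, hF1b⟩ := aux_L1 hFc hFI
  obtain ⟨hG1, -⟩ := aux_L1 hGc hGI
  obtain ⟨hG2, hG2b⟩ := aux_L2 hGc hGI
  rw [hFA] at hF1b
  rw [hGB] at hG2b
  have part1 : ∀ x : ℝ, 0 < x → Integrable (mbConvIntegrand f g x) := by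
    intro x hx
    have hx0 : (x : ℂ) ≠ 0 := by exact_mod_cast hx.ne'
    have hEc : Continuous fun p : ℝ × ℝ =>
        (x : ℂ) ^ (-(1/2) + ((p.1 + p.2 : ℝ) : ℂ) * Complex.I : ℂ) :=
      Continuous.const_cpow (by fun_prop) (Or.inl hx0)
    have hc : Continuous (mbConvIntegrand f g x) := by
      rw [show mbConvIntegrand f g x = _ from funext fun p => aux_integrand f g x p]
      exact ((aux_kernel_cont.mul (hFc.comp continuous_fst)).mul (hGc.comp continuous_snd)).mul hEc
    have hi : Integrable (fun p : ℝ × ℝ =>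
        Real.sqrt (8 * π) * x ^ (-(1/2) : ℝ) * (‖F p.1‖ * ‖G p.2‖)) := by
      rw [Measure.volume_eq_prod]
      exact (hF1.norm.mul_prod hG1.norm).const_mul _
    refine hi.mono' hc.aestronglyMeasurable (Eventually.of_forall fun p => ?_)
    rw [aux_integrand, norm_mul, norm_mul, norm_mul, Complex.norm_cpow_eq_rpow_re_of_pos hx]
    have hre : (-(1/2) + ((p.1 + p.2 : ℝ) : ℂ) * Complex.I : ℂ).re = -(1/2) := by simp
    rw [hre]
    have hk := aux_kernel_bound' p
    calc _ = ‖mbKernel (1 / 2 + p.1 * Complex.I) (1 / 2 + p.2 * Complex.I)‖ *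
          (x ^ (-(1/2) : ℝ) * (‖F p.1‖ * ‖G p.2‖)) := by simp only [hFdef, hGdef]; ring
      _ ≤ Real.sqrt (8 * π) * (x ^ (-(1/2) : ℝ) * (‖F p.1‖ * ‖G p.2‖)) :=
          mul_le_mul_of_nonneg_right hk (by positivity)
      _ = _ := by ring
  obtain ⟨hm, hb⟩ := aux_main aux_kernel_cont aux_kernel_bound' hFc hGc hF1 hG1 hG2
    (mbConv f g) ((((2 * π) ^ 2)⁻¹ : ℝ) : ℂ) (fun x _ => by
      unfold mbConv
      simp only [aux_integrand, hFdef, hGdef])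
  have hG2n : 0 ≤ ∫ t, ‖G t‖ ^ 2 := integral_nonneg fun τ => by positivity
  have hle : 2 * π * ‖((((2 * π) ^ 2)⁻¹ : ℝ) : ℂ)‖ ^ 2 * Real.sqrt (8 * π) ^ 2 *
      (∫ t, ‖F t‖) ^ 2 * ∫ t, ‖G t‖ ^ 2 ≤ 32 / π * (A * B) := by
    rw [Complex.norm_real, Real.norm_eq_abs, sq_abs, Real.sq_sqrt (by positivity)]
    calc _ ≤ 2 * π * (((2 * π) ^ 2)⁻¹) ^ 2 * (8 * π) * (2 * π * A) * (4 * B) := by gcongr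
      _ = 8 / π * (A * B) := by field_simp; ring
      _ ≤ _ := by gcongr; norm_num
  have hb2 := hb.trans (ENNReal.ofReal_le_ofReal hle)
  have hmem : MemLp (mbConv f g) 2 (volume.restrict (Ioi (0 : ℝ))) := by
    refine ⟨hm, ?_⟩
    have : eLpNorm (mbConv f g) 2 (volume.restrict (Ioi (0 : ℝ))) ^ 2 < ⊤ := by
      rw [aux_eLpNorm_sq]; exact hb2.trans_lt ENNReal.ofReal_lt_top
    by_contra hcon
    rw [not_lt, top_le_iff] at hcon
    rw [hcon] at this
    simp at this
  refine ⟨part1, hmem, ?_⟩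
  have hint : ∫ x in Ioi (0 : ℝ), ‖mbConv f g x‖ ^ 2 ≤ 32 / π * (A * B) := by
    have hm2 : AEStronglyMeasurable (fun x => ‖mbConv f g x‖ ^ 2) (volume.restrict (Ioi (0 : ℝ))) :=
      hm.norm.pow 2
    rw [integral_eq_lintegral_of_nonneg_ae (Eventually.of_forall fun x => by positivity)
      hm2]
    refine ENNReal.toReal_le_of_le_ofReal (by positivity) (le_of_eq_of_le ?_ hb2)
    congr 1; ext x
    rw [ENNReal.ofReal_pow (norm_nonneg _), ofReal_norm]
  rw [← Real.sqrt_eq_rpow, ← Real.sqrt_eq_rpow, ← Real.sqrt_eq_rpow]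
  refine Real.sqrt_le_iff.2 ⟨by positivity, hint.trans (le_of_eq ?_)⟩
  rw [mul_pow, mul_pow, mul_pow, Real.sq_sqrt A0, Real.sq_sqrt B0, Real.sq_sqrt (by positivity)]
  ring
end

section
/- Necessary Mellin functional equation for eigenfunctions: let λ ∈ ℂ and let f ∈ L¹(0,∞) ∩ L²(0,∞) satisfy ∫₀^∞ |f(t)| t^{−1/2} dt < ∞. If √(2/π) ∫₀^∞ (cos(xt) + sin(xt)) f(t) dt = λ f(x) for almost every x > 0, then the Mellin transform f* of f satisfies λ f*(s) = √(2/π) Γ(s) [sin(πs/2) + cos(πs/2)] f*(1−s) for every s with Re s = 1/2. -/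
open MeasureTheory Set Filter
open scoped Real

lemma hh_gauss_int' (s : ℂ) (hs : 0 < s.re) (r : ℂ) (hr : 0 < r.re) :
    IntegrableOn (fun x : ℝ => (x : ℂ) ^ (s - 1) * Complex.exp (-(r * x))) (Ioi 0) := by
  have h1 : IntegrableOn (fun x : ℝ => x ^ (s.re - 1) * Real.exp (- r.re * x)) (Ioi 0) :=
    by simpa using integrableOn_rpow_mul_exp_neg_mul_rpow (s := s.re - 1) (p := 1) (b := r.re)
        (by linarith) (by norm_num) hr
  refine Integrable.mono' h1 ?_ ?_
  · apply ContinuousOn.aestronglyMeasurable _ measurableSet_Ioi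
    apply ContinuousOn.mul
    · intro x hx
      apply ContinuousAt.continuousWithinAt
      exact Complex.continuousAt_ofReal_cpow_const x (s - 1) (Or.inr (ne_of_gt hx))
    · fun_prop
  · filter_upwards [ae_restrict_mem measurableSet_Ioi] with x hx
    rw [norm_mul, Complex.norm_cpow_eq_rpow_re_of_pos hx, Complex.norm_exp]
    simp

lemma hh_gauss_int (s : ℂ) (hs : s.re = 1 / 2) (r : ℂ) (hr : 0 < r.re) :
    IntegrableOn (fun x : ℝ => (x : ℂ) ^ (s - 1) * Complex.exp (-(r * x))) (Ioi 0) :=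
  hh_gauss_int' s (by rw [hs]; norm_num) r hr

lemma hh_laplace_diff (s : ℂ) (hs : 0 < s.re) (r : ℂ) (hr : 0 < r.re) :
    DifferentiableAt ℂ (fun r : ℂ => ∫ x in Ioi (0 : ℝ),
      (x : ℂ) ^ (s - 1) * Complex.exp (-(r * x))) r := by
  have hb : IntegrableOn (fun x : ℝ => x ^ s.re * Real.exp (- (r.re / 2) * x)) (Ioi 0) :=
    by simpa using integrableOn_rpow_mul_exp_neg_mul_rpow (s := s.re) (p := 1) (b := r.re / 2)
        (by linarith) (by norm_num) (by linarith)
  have hball : ∀ z ∈ Metric.ball r (r.re / 2), r.re / 2 < z.re := by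
    intro z hz
    rw [Metric.mem_ball, dist_eq_norm] at hz
    have := (abs_le.mp (Complex.abs_re_le_norm (z - r))).1
    simp at this
    linarith
  have hcont : ∀ z : ℂ, ContinuousOn
      (fun x : ℝ => (x : ℂ) ^ (s - 1) * Complex.exp (-(z * x))) (Ioi 0) := by
    intro z
    apply ContinuousOn.mul
    · intro x hx
      apply ContinuousAt.continuousWithinAt
      exact Complex.continuousAt_ofReal_cpow_const x (s - 1) (Or.inr (ne_of_gt hx))
    · fun_prop
  have := hasDerivAt_integral_of_dominated_loc_of_deriv_le
    (μ := volume.restrict (Ioi (0 : ℝ)))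
    (F := fun (z : ℂ) (x : ℝ) => (x : ℂ) ^ (s - 1) * Complex.exp (-(z * x)))
    (F' := fun (z : ℂ) (x : ℝ) => (x : ℂ) ^ (s - 1) * Complex.exp (-(z * x)) * (-x))
    (x₀ := r) (Metric.ball_mem_nhds r (show 0 < r.re / 2 by linarith))
    (bound := fun x : ℝ => x ^ s.re * Real.exp (- (r.re / 2) * x))
    (Eventually.of_forall fun z => (hcont z).aestronglyMeasurable measurableSet_Ioi)
    (hh_gauss_int' s hs r hr)
    (((hcont r).mul (by fun_prop)).aestronglyMeasurable measurableSet_Ioi)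
    ?_ hb ?_
  · exact this.2.differentiableAt
  · filter_upwards [ae_restrict_mem measurableSet_Ioi] with x hx z hz
    have hx' : 0 < x := hx
    have hz' := hball z hz
    rw [norm_mul, norm_mul, Complex.norm_cpow_eq_rpow_re_of_pos hx, Complex.norm_exp, norm_neg,
      Complex.norm_real, Real.norm_eq_abs, abs_of_pos hx']
    have e : x ^ s.re = x ^ (s - 1).re * x := by
      rw [← Real.rpow_add_one hx'.ne']
      simp
    have e2 : (-(z * (x : ℂ))).re ≤ -(r.re / 2) * x := by
      simp
      nlinarith
    rw [e]
    calc _ ≤ x ^ (s - 1).re * Real.exp (-(r.re / 2) * x) * x := by gcongr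
      _ = _ := by ring
  · filter_upwards with x z hz
    have h0 : HasDerivAt (fun z : ℂ => -(z * (x : ℂ))) (-(x : ℂ)) z := by
      have := (hasDerivAt_id z).mul_const (-(x : ℂ))
      simpa using this
    have := h0.cexp.const_mul ((x : ℂ) ^ (s - 1))
    simpa only [mul_assoc] using this

lemma hh_laplace (s : ℂ) (hs : 0 < s.re) (r : ℂ) (hr : 0 < r.re) :
    ∫ x in Ioi (0 : ℝ), (x : ℂ) ^ (s - 1) * Complex.exp (-(r * x)) =
      (1 / r) ^ s * Complex.Gamma s := by
  have hopen : IsOpen {z : ℂ | 0 < z.re} := isOpen_lt continuous_const Complex.continuous_re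
  have hA : AnalyticOnNhd ℂ (fun r : ℂ => ∫ x in Ioi (0 : ℝ),
      (x : ℂ) ^ (s - 1) * Complex.exp (-(r * x))) {z : ℂ | 0 < z.re} :=
    DifferentiableOn.analyticOnNhd
      (fun z hz => (hh_laplace_diff s hs z hz).differentiableWithinAt) hopen
  have hB : AnalyticOnNhd ℂ (fun r : ℂ => (1 / r) ^ s * Complex.Gamma s) {z : ℂ | 0 < z.re} := by
    refine DifferentiableOn.analyticOnNhd (fun z hz => ?_) hopen
    have hz' : 0 < z.re := hz
    have hz0 : z ≠ 0 := by rintro rfl; simp at hz'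
    apply DifferentiableAt.differentiableWithinAt
    refine DifferentiableAt.mul_const ?_ _
    refine DifferentiableAt.cpow ?_ (differentiableAt_const _) ?_
    · exact (differentiableAt_const _).div differentiableAt_id hz0
    · rw [one_div, Complex.mem_slitPlane_iff]
      left
      rw [Complex.inv_re]
      exact div_pos hz' (Complex.normSq_pos.mpr hz0)
  refine hA.eqOn_of_preconnected_of_frequently_eq hB
    (convex_halfSpace_re_gt 0).isPreconnected (z₀ := 1) (by simp) ?_ hr
  have ht : Tendsto (fun x : ℝ => (x : ℂ)) (nhdsWithin 1 (Ioi 1)) (nhdsWithin 1 {1}ᶜ) := by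
    refine tendsto_nhdsWithin_iff.mpr ⟨?_, ?_⟩
    · have : ContinuousAt (fun x : ℝ => (x : ℂ)) 1 := by fun_prop
      simpa using this.tendsto.mono_left (nhdsWithin_le_nhds (s := Ioi 1))
    · filter_upwards [self_mem_nhdsWithin] with x hx
      have hx' : (1 : ℝ) < x := hx
      simpa using hx'.ne'
  refine ht.frequently (Eventually.frequently ?_)
  filter_upwards [self_mem_nhdsWithin] with x hx
  have hx' : (1 : ℝ) < x := hx
  exact Complex.integral_cpow_mul_exp_neg_mul_Ioi hs (by linarith)

lemma hh_kernel (s : ℂ) (hs : s.re = 1 / 2) (ε : ℝ) (hε : 0 < ε) (t : ℝ) :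
    ∫ x in Ioi (0 : ℝ), ((x : ℂ) ^ (s - 1) * Complex.exp (-(ε * x))) *
        ((Real.cos (x * t) + Real.sin (x * t) : ℝ) : ℂ) =
      Complex.Gamma s * ((1 - Complex.I) / 2 * (1 / ((ε : ℂ) + (-1 : ℝ) * t * Complex.I)) ^ s +
        (1 + Complex.I) / 2 * (1 / ((ε : ℂ) + (1 : ℝ) * t * Complex.I)) ^ s) := by
  have hr1 : 0 < ((ε : ℂ) + (-1 : ℝ) * t * Complex.I).re := by simpa using hε
  have hr2 : 0 < ((ε : ℂ) + (1 : ℝ) * t * Complex.I).re := by simpa using hε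
  have hs0 : 0 < s.re := by rw [hs]; norm_num
  have e1 := hh_laplace s hs0 _ hr1
  have e2 := hh_laplace s hs0 _ hr2
  have i1 := hh_gauss_int s hs _ hr1
  have i2 := hh_gauss_int s hs _ hr2
  have : ∀ x : ℝ, ((x : ℂ) ^ (s - 1) * Complex.exp (-(ε * x))) *
        ((Real.cos (x * t) + Real.sin (x * t) : ℝ) : ℂ) =
      (1 - Complex.I) / 2 * ((x : ℂ) ^ (s - 1) *
          Complex.exp (-(((ε : ℂ) + (-1 : ℝ) * t * Complex.I) * x))) +
      (1 + Complex.I) / 2 * ((x : ℂ) ^ (s - 1) *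
          Complex.exp (-(((ε : ℂ) + (1 : ℝ) * t * Complex.I) * x))) := by
    intro x
    have a1 : -(((ε : ℂ) + (-1 : ℝ) * t * Complex.I) * x) =
      -(ε * x) + (x * t : ℂ) * Complex.I := by push_cast; ring
    have a2 : -(((ε : ℂ) + (1 : ℝ) * t * Complex.I) * x) =
      -(ε * x) + (-(x * t : ℂ)) * Complex.I := by push_cast; ring
    rw [a1, a2, Complex.exp_add, Complex.exp_add, Complex.exp_mul_I, Complex.exp_mul_I]
    rw [Complex.cos_neg, Complex.sin_neg]
    push_cast
    linear_combination ((x : ℂ) ^ (s - 1) * Complex.exp (-(ε * x))) *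
      Complex.sin (x * t) * Complex.I_sq
  simp_rw [this]
  rw [integral_add (i1.const_mul _) (i2.const_mul _), integral_const_mul, integral_const_mul,
    e1, e2]
  ring

lemma hh_cpow_bound (s : ℂ) (hs : s.re = 1 / 2) (c : ℝ) (hc : |c| = 1) (ε t : ℝ)
    (ht : 0 < t) :
    ‖(1 / ((ε : ℂ) + c * t * Complex.I)) ^ s‖ ≤ Real.exp (π * |s.im|) * (1 / Real.sqrt t) := by
  have hn : t ≤ ‖(ε : ℂ) + c * t * Complex.I‖ := by
    have := Complex.abs_im_le_norm ((ε : ℂ) + c * t * Complex.I)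
    simpa [abs_mul, hc, abs_of_pos ht] using this
  refine (Complex.norm_cpow_le _ _).trans ?_
  rw [hs, ← Real.sqrt_eq_rpow, div_eq_mul_inv, ← Real.exp_neg, mul_comm]
  gcongr
  · refine (neg_le_abs _).trans ?_
    rw [abs_mul]
    gcongr
    exact Complex.abs_arg_le_pi _
  · rw [norm_div, norm_one, Real.sqrt_div zero_le_one, Real.sqrt_one]
    gcongr

lemma hh_limit_s16 (s : ℂ) (hs : s.re = 1 / 2) (c : ℝ) (hc : |c| = 1) (f : ℝ → ℂ)
    (h1 : IntegrableOn f (Ioi (0 : ℝ)))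
    (hm : IntegrableOn (fun t : ℝ => ‖f t‖ / Real.sqrt t) (Ioi 0)) :
    (∀ ε : ℝ, 0 ≤ ε →
      IntegrableOn (fun t : ℝ => (1 / ((ε : ℂ) + c * t * Complex.I)) ^ s * f t) (Ioi 0)) ∧
    Tendsto (fun ε : ℝ => ∫ t in Ioi (0 : ℝ), (1 / ((ε : ℂ) + c * t * Complex.I)) ^ s * f t)
      (nhdsWithin 0 (Ioi 0))
      (nhds (∫ t in Ioi (0 : ℝ), (1 / (((0 : ℝ) : ℂ) + c * t * Complex.I)) ^ s * f t)) := by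
  have hc0 : c ≠ 0 := by rintro rfl; simp at hc
  have hslit : ∀ ε t : ℝ, 0 < t → 1 / ((ε : ℂ) + c * t * Complex.I) ∈ Complex.slitPlane := by
    intro ε t ht
    have hz : (ε : ℂ) + c * t * Complex.I ≠ 0 := by
      intro h
      have := congrArg Complex.im h
      simp [hc0, ht.ne'] at this
    rw [one_div, Complex.mem_slitPlane_iff]
    right
    rw [Complex.inv_im]
    refine div_ne_zero ?_ (by simpa using hz)
    simp [hc0, ht.ne']
  have hne : ∀ ε t : ℝ, 0 < t → (ε : ℂ) + c * t * Complex.I ≠ 0 := by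
    intro ε t ht h
    have := congrArg Complex.im h
    simp [hc0, ht.ne'] at this
  have hmeas : ∀ ε : ℝ, AEStronglyMeasurable
      (fun t : ℝ => (1 / ((ε : ℂ) + c * t * Complex.I)) ^ s * f t)
      (volume.restrict (Ioi 0)) := by
    intro ε
    refine AEStronglyMeasurable.mul ?_ h1.aestronglyMeasurable
    apply ContinuousOn.aestronglyMeasurable _ measurableSet_Ioi
    intro t ht
    apply ContinuousAt.continuousWithinAt
    refine ContinuousAt.cpow ?_ continuousAt_const (hslit ε t ht)
    exact ContinuousAt.div continuousAt_const (by fun_prop) (hne ε t ht)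
  have hb : ∀ ε : ℝ, ∀ᵐ t ∂(volume.restrict (Ioi (0 : ℝ))),
      ‖(1 / ((ε : ℂ) + c * t * Complex.I)) ^ s * f t‖ ≤
        Real.exp (π * |s.im|) * (‖f t‖ / Real.sqrt t) := by
    intro ε
    filter_upwards [ae_restrict_mem measurableSet_Ioi] with t ht
    rw [norm_mul]
    calc _ ≤ Real.exp (π * |s.im|) * (1 / Real.sqrt t) * ‖f t‖ := by
            gcongr; exact hh_cpow_bound s hs c hc ε t ht
      _ = _ := by ring
  refine ⟨fun ε _ => Integrable.mono' (hm.const_mul _) (hmeas ε) (hb ε), ?_⟩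
  refine tendsto_integral_filter_of_dominated_convergence
    (fun t => Real.exp (π * |s.im|) * (‖f t‖ / Real.sqrt t))
    (Eventually.of_forall hmeas) (Eventually.of_forall hb) (hm.const_mul _) ?_
  filter_upwards [ae_restrict_mem measurableSet_Ioi] with t ht
  apply Tendsto.mul_const
  have : ContinuousAt (fun ε : ℝ => (1 / ((ε : ℂ) + c * t * Complex.I)) ^ s) 0 := by
    refine ContinuousAt.cpow ?_ continuousAt_const (hslit 0 t ht)
    exact ContinuousAt.div continuousAt_const (by fun_prop) (hne 0 t ht)
  exact this.tendsto.mono_left nhdsWithin_le_nhds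

lemma hh_cpow_comb (s : ℂ) (t : ℝ) (ht : 0 < t) :
    (1 - Complex.I) / 2 * (1 / (((0 : ℝ) : ℂ) + (-1 : ℝ) * t * Complex.I)) ^ s +
        (1 + Complex.I) / 2 * (1 / (((0 : ℝ) : ℂ) + (1 : ℝ) * t * Complex.I)) ^ s =
      (Complex.sin (π * s / 2) + Complex.cos (π * s / 2)) * (t : ℂ) ^ (1 - s - 1) := by
  have htc : (t : ℂ) ≠ 0 := by exact_mod_cast ht.ne'
  have ht' : 0 < t⁻¹ := inv_pos.mpr ht
  have a1 : 1 / (((0 : ℝ) : ℂ) + (-1 : ℝ) * t * Complex.I) = ((t⁻¹ : ℝ) : ℂ) * Complex.I := by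
    push_cast
    field_simp
    simp
    linear_combination (t : ℂ) * Complex.I_sq
  have a2 : 1 / (((0 : ℝ) : ℂ) + (1 : ℝ) * t * Complex.I) = ((t⁻¹ : ℝ) : ℂ) * (-Complex.I) := by
    push_cast
    field_simp
    simp
    linear_combination (t : ℂ) * Complex.I_sq
  have hI := Complex.I_ne_zero
  have hti : ((t⁻¹ : ℝ) : ℂ) ≠ 0 := by exact_mod_cast ht'.ne'
  rw [a1, a2, Complex.cpow_def_of_ne_zero (mul_ne_zero hti hI),
    Complex.cpow_def_of_ne_zero (mul_ne_zero hti (neg_ne_zero.mpr hI)),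
    Complex.cpow_def_of_ne_zero htc, Complex.log_ofReal_mul ht' hI,
    Complex.log_ofReal_mul ht' (neg_ne_zero.mpr hI), Complex.log_I, Complex.log_neg_I,
    Real.log_inv, ← Complex.ofReal_log ht.le]
  have b1 : (((-Real.log t : ℝ) : ℂ) + π / 2 * Complex.I) * s =
    (Real.log t : ℂ) * (1 - s - 1) + (π * s / 2) * Complex.I := by push_cast; ring
  have b2 : (((-Real.log t : ℝ) : ℂ) + -(π / 2) * Complex.I) * s =
    (Real.log t : ℂ) * (1 - s - 1) + (-(π * s / 2)) * Complex.I := by push_cast; ring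
  rw [b1, b2, Complex.exp_add, Complex.exp_add, Complex.exp_mul_I, Complex.exp_mul_I,
    Complex.cos_neg, Complex.sin_neg]
  linear_combination -Complex.exp ((Real.log t : ℂ) * (1 - s - 1)) *
    Complex.sin (π * s / 2) * Complex.I_sq

lemma hh_mellin_reg (s : ℂ) (hs : s.re = 1 / 2) (f : ℝ → ℂ)
    (h1 : IntegrableOn f (Ioi (0 : ℝ)))
    (hm : IntegrableOn (fun t : ℝ => ‖f t‖ / Real.sqrt t) (Ioi 0)) :
    Tendsto (fun ε : ℝ => ∫ x in Ioi (0 : ℝ),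
        ((x : ℂ) ^ (s - 1) * Complex.exp (-(ε * x))) * f x)
      (nhdsWithin 0 (Ioi 0)) (nhds (mellin f s)) := by
  unfold mellin
  refine tendsto_integral_filter_of_dominated_convergence
    (fun t => ‖f t‖ / Real.sqrt t) (Eventually.of_forall ?_) ?_ hm ?_
  · intro ε
    refine AEStronglyMeasurable.mul ?_ h1.aestronglyMeasurable
    apply ContinuousOn.aestronglyMeasurable _ measurableSet_Ioi
    apply ContinuousOn.mul
    · intro x hx
      apply ContinuousAt.continuousWithinAt
      exact Complex.continuousAt_ofReal_cpow_const x (s - 1) (Or.inr (ne_of_gt hx))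
    · fun_prop
  · filter_upwards [self_mem_nhdsWithin] with ε hε
    filter_upwards [ae_restrict_mem measurableSet_Ioi] with x hx
    have hε' : 0 < ε := hε
    have hx' : 0 < x := hx
    rw [norm_mul, norm_mul, Complex.norm_cpow_eq_rpow_re_of_pos hx, Complex.norm_exp]
    have e : (s - 1).re = -(1/2) := by simp [hs]; norm_num
    rw [e, Real.rpow_neg hx'.le, ← Real.sqrt_eq_rpow]
    have : Real.exp (-((ε : ℂ) * x)).re ≤ 1 := by
      rw [Real.exp_le_one_iff]
      simp
      positivity
    calc _ ≤ (Real.sqrt x)⁻¹ * 1 * ‖f x‖ := by gcongr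
      _ = _ := by ring
  · refine Eventually.of_forall fun x => ?_
    have : ContinuousAt (fun ε : ℝ =>
        ((x : ℂ) ^ (s - 1) * Complex.exp (-(ε * x))) * f x) 0 := by fun_prop
    have h := this.tendsto.mono_left (nhdsWithin_le_nhds (s := Ioi 0))
    simpa using h

/-- Necessary Mellin functional equation for eigenfunctions of the half-Hartley
transform: if `H₊f = λ f` a.e. on `(0,∞)`, then
`λ f*(s) = √(2/π) Γ(s)[sin(πs/2) + cos(πs/2)] f*(1-s)` on the critical line. -/
theorem halfHartley_eigen_mellin_eq (lam : ℂ) (f : ℝ → ℂ)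
    (h1 : IntegrableOn f (Ioi (0 : ℝ)))
    (h2 : MemLp f 2 (volume.restrict (Ioi (0 : ℝ))))
    (hm : IntegrableOn (fun t : ℝ => ‖f t‖ / Real.sqrt t) (Ioi 0))
    (heig : ∀ᵐ x ∂(volume.restrict (Ioi (0 : ℝ))),
      (Real.sqrt (2 / π) : ℂ) *
          ∫ t in Ioi (0 : ℝ), ((Real.cos (x * t) + Real.sin (x * t) : ℝ) : ℂ) * f t =
        lam * f x) :
    ∀ s : ℂ, s.re = 1 / 2 →
      lam * mellin f s =
        (Real.sqrt (2 / π) : ℂ) * Complex.Gamma s *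
          (Complex.sin (π * s / 2) + Complex.cos (π * s / 2)) * mellin f (1 - s) := by
  intro s hs
  obtain ⟨im, tm⟩ := hh_limit_s16 s hs (-1) (by simp) f h1 hm
  obtain ⟨ip, tp⟩ := hh_limit_s16 s hs 1 (by simp) f h1 hm
  have L := (hh_mellin_reg s hs f h1 hm).const_mul lam
  have R := (((tm.const_mul ((1 - Complex.I) / 2)).add
    (tp.const_mul ((1 + Complex.I) / 2))).const_mul
      ((Real.sqrt (2 / π) : ℂ) * Complex.Gamma s))
  have key : ∀ᶠ ε : ℝ in nhdsWithin 0 (Ioi 0), lam * (∫ x in Ioi (0 : ℝ),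
        ((x : ℂ) ^ (s - 1) * Complex.exp (-(ε * x))) * f x) =
      (Real.sqrt (2 / π) : ℂ) * Complex.Gamma s *
        ((1 - Complex.I) / 2 *
            (∫ t in Ioi (0 : ℝ), (1 / ((ε : ℂ) + (-1 : ℝ) * t * Complex.I)) ^ s * f t) +
          (1 + Complex.I) / 2 *
            (∫ t in Ioi (0 : ℝ), (1 / ((ε : ℂ) + (1 : ℝ) * t * Complex.I)) ^ s * f t)) := by
    filter_upwards [self_mem_nhdsWithin] with ε hε
    have hε' : 0 < ε := hε
    have hg := hh_gauss_int s hs (ε : ℂ) (by simpa using hε')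
    have hprod : Integrable (Function.uncurry fun x t : ℝ =>
        ((x : ℂ) ^ (s - 1) * Complex.exp (-(ε * x))) *
          (((Real.cos (x * t) + Real.sin (x * t) : ℝ) : ℂ) * f t))
        ((volume.restrict (Ioi (0 : ℝ))).prod (volume.restrict (Ioi (0 : ℝ)))) := by
      have h := Integrable.mul_prod hg h1
      have h' := h.bdd_mul (c := 2)
        (f := fun p : ℝ × ℝ => ((Real.cos (p.1 * p.2) + Real.sin (p.1 * p.2) : ℝ) : ℂ))
        (Continuous.aestronglyMeasurable (by fun_prop)) (Eventually.of_forall fun p => by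
          rw [Complex.norm_real, Real.norm_eq_abs]
          refine (abs_add_le _ _).trans ?_
          linarith [Real.abs_cos_le_one (p.1 * p.2), Real.abs_sin_le_one (p.1 * p.2)])
      refine h'.congr (Eventually.of_forall fun p => ?_)
      simp only [Function.uncurry]
      ring
    calc _ = ∫ x in Ioi (0 : ℝ), (Real.sqrt (2 / π) : ℂ) * ∫ t in Ioi (0 : ℝ),
          ((x : ℂ) ^ (s - 1) * Complex.exp (-(ε * x))) *
          (((Real.cos (x * t) + Real.sin (x * t) : ℝ) : ℂ) * f t) := by
            rw [← integral_const_mul]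
            apply integral_congr_ae
            filter_upwards [heig] with x hx
            rw [integral_const_mul]
            linear_combination -((x : ℂ) ^ (s - 1) * Complex.exp (-(ε * x))) * hx
      _ = (Real.sqrt (2 / π) : ℂ) * ∫ t in Ioi (0 : ℝ), ∫ x in Ioi (0 : ℝ),
          ((x : ℂ) ^ (s - 1) * Complex.exp (-(ε * x))) *
          (((Real.cos (x * t) + Real.sin (x * t) : ℝ) : ℂ) * f t) := by
            rw [integral_const_mul, integral_integral_swap hprod]
      _ = (Real.sqrt (2 / π) : ℂ) * ∫ t in Ioi (0 : ℝ), (Complex.Gamma s * ((1 - Complex.I) / 2 *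
              ((1 / ((ε : ℂ) + (-1 : ℝ) * t * Complex.I)) ^ s * f t) +
            (1 + Complex.I) / 2 * ((1 / ((ε : ℂ) + (1 : ℝ) * t * Complex.I)) ^ s * f t))) := by
            congr 2
            funext t
            simp_rw [← mul_assoc]
            rw [integral_mul_const, hh_kernel s hs ε hε' t]
            ring
      _ = _ := by
            rw [integral_const_mul, integral_add ((im ε hε'.le).const_mul _)
              ((ip ε hε'.le).const_mul _), integral_const_mul, integral_const_mul]
            ring
  have fin := tendsto_nhds_unique (L.congr' key) R
  rw [fin, mul_assoc _ (Complex.sin (π * s / 2) + Complex.cos (π * s / 2)), ← integral_const_mul,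
    ← integral_const_mul, ← integral_add ((im 0 le_rfl).const_mul _) ((ip 0 le_rfl).const_mul _)]
  congr 1
  unfold mellin
  rw [← integral_const_mul]
  apply setIntegral_congr_fun measurableSet_Ioi
  intro t ht
  simp only [smul_eq_mul]
  linear_combination f t * hh_cpow_comb s t ht
end

section
/- For every real τ, with s = 1/2 + iτ, the identity |√(π/2) (sec(πs/2) + csc(πs/2))/Γ(s)| = 2 cosh(πτ/2)/√(cosh(πτ)) holds, and consequently √2 ≤ |√(π/2) (sec(πs/2) + csc(πs/2))/Γ(s)| ≤ 2. -/
open MeasureTheory Set Filter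
open scoped Real

theorem sin_aux (x : ℝ) : Complex.sin (π / 2 + x * Complex.I) = (Real.cosh x : ℂ) := by
  rw [add_comm, Complex.sin_add_pi_div_two, Complex.cos_mul_I, Complex.ofReal_cosh]

theorem gamma_aux (τ : ℝ) :
    ‖Complex.Gamma (1 / 2 + τ * Complex.I)‖ = Real.sqrt (π / Real.cosh (π * τ)) := by
  have h := Complex.Gamma_mul_Gamma_one_sub (1 / 2 + τ * Complex.I)
  have e1 : (1 : ℂ) - (1 / 2 + τ * Complex.I) =
      (starRingEnd ℂ) (1 / 2 + τ * Complex.I) := by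
    apply Complex.ext
    · simp; norm_num
    · simp
  have e2 : (π : ℂ) * (1 / 2 + τ * Complex.I) = π / 2 + ((π * τ : ℝ) : ℂ) * Complex.I := by
    push_cast; ring
  rw [e1, Complex.Gamma_conj, Complex.mul_conj, e2, sin_aux, ← Complex.ofReal_div] at h
  have h' := Complex.ofReal_injective h
  rw [← h', Complex.normSq_eq_norm_sq, Real.sqrt_sq (norm_nonneg _)]

theorem sec_csc_aux (τ : ℝ) :
    1 / Complex.cos (π * (1 / 2 + τ * Complex.I) / 2) +
      1 / Complex.sin (π * (1 / 2 + τ * Complex.I) / 2) =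
    ((2 * Real.sqrt 2 * Real.cosh (π * τ / 2) / Real.cosh (π * τ) : ℝ) : ℂ) := by
  set z : ℂ := π * (1 / 2 + τ * Complex.I) / 2 with hz
  have hC : (Real.cosh (π * τ) : ℂ) ≠ 0 :=
    Complex.ofReal_ne_zero.mpr (Real.cosh_pos _).ne'
  have hprod : 2 * Complex.sin z * Complex.cos z = (Real.cosh (π * τ) : ℂ) := by
    rw [← Complex.sin_two_mul, ← sin_aux]
    congr 1
    rw [hz]; push_cast; ring
  have hs : Complex.sin z ≠ 0 := by
    intro h; rw [h] at hprod; apply hC; rw [← hprod]; ring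
  have hc : Complex.cos z ≠ 0 := by
    intro h; rw [h] at hprod; apply hC; rw [← hprod]; ring
  have h2 : ((Real.sqrt 2 : ℝ) : ℂ) * (Real.sqrt 2 : ℝ) = 2 := by
    rw [← Complex.ofReal_mul, Real.mul_self_sqrt (by norm_num)]; norm_num
  have hsum : Complex.sin z + Complex.cos z =
      (Real.sqrt 2 : ℂ) * (Real.cosh (π * τ / 2) : ℂ) := by
    have e : z + π / 4 = π / 2 + ((π * τ / 2 : ℝ) : ℂ) * Complex.I := by
      rw [hz]; push_cast; ring
    have hs4 : Complex.sin ((π : ℂ) / 4) = ((Real.sqrt 2 / 2 : ℝ) : ℂ) := by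
      rw [← Real.sin_pi_div_four]; push_cast; rfl
    have hc4 : Complex.cos ((π : ℂ) / 4) = ((Real.sqrt 2 / 2 : ℝ) : ℂ) := by
      rw [← Real.cos_pi_div_four]; push_cast; rfl
    rw [← sin_aux, ← e, Complex.sin_add, hs4, hc4]
    push_cast
    linear_combination (-(Complex.sin z + Complex.cos z) / 2) * h2
  have : 1 / Complex.cos z + 1 / Complex.sin z =
      2 * (Complex.sin z + Complex.cos z) / (2 * Complex.sin z * Complex.cos z) := by
    field_simp
  rw [this, hprod, hsum]
  push_cast
  ring

theorem norm_aux (τ : ℝ) :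
    norm ((Real.sqrt (π / 2) : ℂ) *
        (1 / Complex.cos (π * (1 / 2 + τ * Complex.I) / 2) +
          1 / Complex.sin (π * (1 / 2 + τ * Complex.I) / 2)) /
        Complex.Gamma (1 / 2 + τ * Complex.I)) =
      2 * Real.cosh (π * τ / 2) / Real.sqrt (Real.cosh (π * τ)) := by
  have hC := Real.cosh_pos (π * τ)
  have hc := Real.cosh_pos (π * τ / 2)
  rw [sec_csc_aux, norm_div, gamma_aux, ← Complex.ofReal_mul, Complex.norm_real,
    Real.norm_of_nonneg (by positivity), Real.sqrt_div Real.pi_pos.le,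
    Real.sqrt_div Real.pi_pos.le]
  have h1 : Real.sqrt π ≠ 0 := (Real.sqrt_pos.mpr Real.pi_pos).ne'
  have h3 : Real.sqrt (Real.cosh (π * τ)) ≠ 0 := (Real.sqrt_pos.mpr hC).ne'
  have h4 := Real.sq_sqrt hC.le
  field_simp
  rw [h4]

/-- The modulus of `√(π/2)(sec(πs/2) + csc(πs/2))/Γ(s)` at `s = 1/2 + iτ` equals
`2 cosh(πτ/2)/√(cosh(πτ))`, and hence lies between `√2` and `2`. -/
theorem multiplier_modulus_bounds (τ : ℝ) :
    norm ((Real.sqrt (π / 2) : ℂ) *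
        (1 / Complex.cos (π * (1 / 2 + τ * Complex.I) / 2) +
          1 / Complex.sin (π * (1 / 2 + τ * Complex.I) / 2)) /
        Complex.Gamma (1 / 2 + τ * Complex.I)) =
      2 * Real.cosh (π * τ / 2) / Real.sqrt (Real.cosh (π * τ)) ∧
    Real.sqrt 2 ≤
      norm ((Real.sqrt (π / 2) : ℂ) *
        (1 / Complex.cos (π * (1 / 2 + τ * Complex.I) / 2) +
          1 / Complex.sin (π * (1 / 2 + τ * Complex.I) / 2)) /
        Complex.Gamma (1 / 2 + τ * Complex.I)) ∧
    norm ((Real.sqrt (π / 2) : ℂ) *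
        (1 / Complex.cos (π * (1 / 2 + τ * Complex.I) / 2) +
          1 / Complex.sin (π * (1 / 2 + τ * Complex.I) / 2)) /
        Complex.Gamma (1 / 2 + τ * Complex.I)) ≤ 2 := by
  rw [norm_aux]
  have hC := Real.cosh_pos (π * τ)
  have hc := Real.one_le_cosh (π * τ / 2)
  have hd : Real.cosh (π * τ) = 2 * Real.cosh (π * τ / 2) ^ 2 - 1 := by
    have h := Real.cosh_two_mul (π * τ / 2)
    rw [Real.sinh_sq, show 2 * (π * τ / 2) = π * τ by ring] at h
    linarith
  have hq := Real.sqrt_pos.mpr hC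
  refine ⟨rfl, ?_, ?_⟩
  · rw [le_div_iff₀ hq, ← Real.sqrt_mul (by norm_num)]
    apply Real.sqrt_le_iff.mpr
    constructor
    · linarith
    · rw [hd]; nlinarith
  · rw [div_le_iff₀ hq]
    have : Real.cosh (π * τ / 2) ≤ Real.sqrt (Real.cosh (π * τ)) := by
      apply Real.le_sqrt_of_sq_le
      rw [hd]; nlinarith
    linarith
end

section
/- Triviality of eigenfunctions for real λ with λ² < 2: let λ ∈ ℝ with |λ| < √2 and let f ∈ L¹(0,∞) ∩ L²(0,∞) satisfy ∫₀^∞ |f(t)| t^{−1/2} dt < ∞. If √(2/π) ∫₀^∞ (cos(xt) + sin(xt)) f(t) dt = λ f(x) for almost every x > 0, then f = 0 almost everywhere on (0,∞). -/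
open MeasureTheory Set Filter
open scoped Real

open scoped FourierTransform in
theorem hh_plancherel_s19 (f : ℝ → ℂ) (h1 : Integrable f) (h2 : MemLp f 2) :
    Continuous (𝓕 f) ∧ MemLp (𝓕 f) 2 ∧ ∫ x, ‖𝓕 f x‖ ^ 2 = ∫ x, ‖f x‖ ^ 2 := by
  have hc : Continuous (𝓕 f) :=
    VectorFourier.fourierIntegral_continuous Real.continuous_fourierChar
      (by exact continuous_inner) h1
  set u : Lp ℂ 2 (volume : Measure ℝ) := h2.toLp f with hu
  have key : (fun x => (𝓕 u : Lp ℂ 2 (volume : Measure ℝ)) x - 𝓕 f x) =ᵐ[volume] 0 := by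
    have hl1 : LocallyIntegrable ((𝓕 u : Lp ℂ 2 (volume : Measure ℝ)) : ℝ → ℂ) :=
      (Lp.memLp _).locallyIntegrable (by norm_num)
    have hl2 : LocallyIntegrable (𝓕 f) := hc.locallyIntegrable
    apply ae_eq_zero_of_integral_contDiff_smul_eq_zero (hl1.sub hl2)
    intro g g_smooth g_cpt
    have hg₁ : HasCompactSupport (Complex.ofRealCLM ∘ g) := g_cpt.comp_left rfl
    have hg₂ : ContDiff ℝ (⊤ : ℕ∞) (Complex.ofRealCLM ∘ g) := by fun_prop
    set G := hg₁.toSchwartzMap hg₂ with hG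
    have e1 : ∫ x, g x • (𝓕 u : Lp ℂ 2 (volume : Measure ℝ)) x
        = ∫ x, (𝓕 G) x • f x := by
      have := congrArg (fun T => T G) (Lp.fourier_toTemperedDistribution_eq u)
      simp only [TemperedDistribution.fourier_apply, Lp.toTemperedDistribution_apply] at this
      calc _ = ∫ x, G x • (𝓕 u : Lp ℂ 2 (volume : Measure ℝ)) x := by simp [hG]
        _ = ∫ x, (𝓕 G) x • u x := this.symm
        _ = _ := by
          apply integral_congr_ae
          filter_upwards [h2.coeFn_toLp] with x hx
          rw [hu, hx]
    have e2 : ∫ x, g x • 𝓕 f x = ∫ x, (𝓕 G) x • f x := by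
      have := VectorFourier.integral_fourierIntegral_smul_eq_flip (μ := volume) (ν := volume)
        (L := innerₗ ℝ) Real.continuous_fourierChar continuous_inner G.integrable h1
      rw [flip_innerₗ] at this
      calc _ = ∫ x, G x • 𝓕 f x := rfl
        _ = _ := this.symm
        _ = _ := by rw [SchwartzMap.fourier_coe]; rfl
    simp_rw [Pi.sub_apply, smul_sub]
    rw [integral_sub, e1, e2, sub_self]
    · exact hl1.integrable_smul_left_of_hasCompactSupport g_smooth.continuous g_cpt
    · exact hl2.integrable_smul_left_of_hasCompactSupport g_smooth.continuous g_cpt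
  have key' : ((𝓕 u : Lp ℂ 2 (volume : Measure ℝ)) : ℝ → ℂ) =ᵐ[volume] 𝓕 f := by
    filter_upwards [key] with x hx
    exact sub_eq_zero.1 hx
  have hm : MemLp (𝓕 f) 2 := (memLp_congr_ae key').1 (Lp.memLp _)
  refine ⟨hc, hm, ?_⟩
  have n1 : ‖(𝓕 u : Lp ℂ 2 (volume : Measure ℝ))‖ = ‖u‖ := Lp.norm_fourier_eq u
  have hsq : ∀ v : Lp ℂ 2 (volume : Measure ℝ), ‖v‖ ^ 2 = ∫ x, ‖v x‖ ^ 2 := by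
    intro v
    have := L2.integral_inner_eq_sq_eLpNorm (𝕜 := ℂ) v
    have h := @inner_self_eq_norm_sq_to_K ℂ _ _ _ _ v
    rw [L2.inner_def] at h
    simp only [inner_self_eq_norm_sq_to_K] at h
    apply Complex.ofReal_injective
    rw [← integral_complex_ofReal]
    simpa using h.symm
  calc _ = ∫ x, ‖(𝓕 u : Lp ℂ 2 (volume : Measure ℝ)) x‖ ^ 2 := by
        apply integral_congr_ae
        filter_upwards [key'] with x hx
        rw [hx]
    _ = ∫ x, ‖u x‖ ^ 2 := by rw [← hsq, ← hsq, n1]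
    _ = _ := by
        apply integral_congr_ae
        filter_upwards [h2.coeFn_toLp] with x hx
        rw [hu, hx]


theorem hh_sin_laplace (e s : ℝ) (he : 0 < e) :
    ∫ x in Ioi (0:ℝ), Real.exp (-e * x) * Real.sin (x * s) = s / (e ^ 2 + s ^ 2) := by
  have ha : ((-e : ℝ) + s * Complex.I : ℂ).re < 0 := by simp [he]
  have h := integral_exp_mul_complex_Ioi ha 0
  have hi := integrableOn_exp_mul_complex_Ioi ha 0
  have h3 := congrArg Complex.im h
  have : (∫ x : ℝ in Ioi 0, Complex.exp (((-e : ℝ) + s * Complex.I : ℂ) * x)).im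
    = ∫ x : ℝ in Ioi 0, (Complex.exp (((-e : ℝ) + s * Complex.I : ℂ) * x)).im :=
    (integral_im hi).symm
  rw [this] at h3
  calc _ = ∫ x : ℝ in Ioi 0, (Complex.exp (((-e : ℝ) + s * Complex.I : ℂ) * x)).im := by
        congr 1; ext x; rw [Complex.exp_im]; simp [mul_comm]
    _ = _ := by
      rw [h3]; simp [Complex.div_im, Complex.normSq_apply]; ring_nf

/-- abstract Fubini argument -/
theorem hh_fubini_s19 {Ω : Type*} [MeasurableSpace Ω] (m : Measure Ω) [SFinite m]
    (G σ : Ω → ℝ) (hσm : Measurable σ) (hσ : ∀ᵐ p ∂m, 0 < σ p) (hG : Integrable G m)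
    (hGσ : Integrable (fun p => G p / σ p) m)
    (hI : IntegrableOn (fun x => ∫ p, G p * Real.sin (x * σ p) ∂m) (Ioi 0)) :
    ∫ x in Ioi (0:ℝ), ∫ p, G p * Real.sin (x * σ p) ∂m
      = ∫ u in Ioi (0:ℝ), ∫ p, G p * Real.exp (-(u * σ p)) ∂m := by
  have hexp : ∀ s : ℝ, 0 < s → ∫ u in Ioi (0:ℝ), Real.exp (-(u * s)) = 1 / s := by
    intro s hs
    have := integral_exp_mul_Ioi (a := -s) (by linarith) 0
    simp only [mul_zero, Real.exp_zero] at this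
    rw [show (1 / s) = -1 / -s by rw [neg_div_neg_eq], ← this]
    congr 1; ext u; ring_nf
  have hexpi : ∀ s : ℝ, 0 < s → IntegrableOn (fun u => Real.exp (-(u * s))) (Ioi (0:ℝ)) := by
    intro s hs
    have := integrableOn_exp_mul_Ioi (a := -s) (by linarith) 0
    refine this.congr_fun ?_ measurableSet_Ioi
    intro u _; simp; ring
  -- right-hand side
  have hR : ∫ u in Ioi (0:ℝ), ∫ p, G p * Real.exp (-(u * σ p)) ∂m = ∫ p, G p / σ p ∂m := by
    rw [integral_integral_swap]
    · apply integral_congr_ae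
      filter_upwards [hσ] with p hp
      rw [integral_const_mul, hexp _ hp]; ring
    · rw [integrable_prod_iff']
      · constructor
        · filter_upwards [hσ] with p hp
          exact (hexpi _ hp).const_mul (G p)
        · refine hGσ.norm.congr ?_
          filter_upwards [hσ] with p hp
          simp only [Function.uncurry, norm_mul, Real.norm_eq_abs, Real.abs_exp, norm_div]
          rw [integral_const_mul, hexp _ hp, abs_of_pos hp]; ring
      · apply AEStronglyMeasurable.mul
        · exact hG.aestronglyMeasurable.comp_snd
        · apply Measurable.aestronglyMeasurable
          fun_prop
  have hL : ∀ e : ℝ, 0 < e → ∫ x in Ioi (0:ℝ), Real.exp (-e * x) * ∫ p, G p * Real.sin (x * σ p) ∂m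
      = ∫ p, G p * (σ p / (e ^ 2 + σ p ^ 2)) ∂m := by
    intro e he
    simp_rw [← integral_const_mul]
    rw [integral_integral_swap]
    · congr 1; ext p
      rw [← hh_sin_laplace e (σ p) he, ← integral_const_mul]
      congr 1; ext x; ring
    · have hb : Integrable (fun z : ℝ × Ω => Real.exp (-e * z.1) * G z.2)
          ((volume.restrict (Ioi (0:ℝ))).prod m) :=
        (integrableOn_exp_mul_Ioi (a := -e) (by linarith) 0).mul_prod hG
      refine hb.mono ?_ ?_
      · apply AEStronglyMeasurable.mul
        · apply Measurable.aestronglyMeasurable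
          fun_prop
        apply AEStronglyMeasurable.mul
        · exact hG.aestronglyMeasurable.comp_snd
        · apply Measurable.aestronglyMeasurable
          fun_prop
      · refine Eventually.of_forall fun z => ?_
        simp only [Function.uncurry, norm_mul]
        have := Real.abs_sin_le_one (z.1 * σ z.2)
        rw [Real.norm_eq_abs (Real.sin _)]
        gcongr
        exact mul_le_of_le_one_right (norm_nonneg _) this
  have ht : Tendsto (fun n : ℕ => 1 / ((n:ℝ) + 1)) atTop (nhds 0) :=
    tendsto_one_div_add_atTop_nhds_zero_nat
  have hpos : ∀ n : ℕ, 0 < 1 / ((n:ℝ) + 1) := fun n => by positivity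
  have T1 : Tendsto (fun n : ℕ => ∫ x in Ioi (0:ℝ), Real.exp (-(1 / ((n:ℝ) + 1)) * x) *
      ∫ p, G p * Real.sin (x * σ p) ∂m) atTop
      (nhds (∫ x in Ioi (0:ℝ), ∫ p, G p * Real.sin (x * σ p) ∂m)) := by
    apply tendsto_integral_of_dominated_convergence _ _ hI.norm
    · intro n
      refine ae_restrict_of_forall_mem measurableSet_Ioi fun x hx => ?_
      rw [norm_mul, Real.norm_eq_abs, Real.abs_exp]
      apply mul_le_of_le_one_left (norm_nonneg _)
      rw [Real.exp_le_one_iff]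
      have := mul_pos (hpos n) hx
      linarith
    · refine Eventually.of_forall fun x => ?_
      have : Tendsto (fun n : ℕ => Real.exp (-(1 / ((n:ℝ) + 1)) * x)) atTop (nhds 1) := by
        have := (ht.neg.mul_const x)
        simp only [neg_zero, zero_mul] at this
        simpa using! (Real.continuous_exp.tendsto 0).comp this
      simpa using this.mul_const (∫ p, G p * Real.sin (x * σ p) ∂m)
    · intro n
      apply AEStronglyMeasurable.mul
      · apply Measurable.aestronglyMeasurable
        fun_prop
      · exact hI.aestronglyMeasurable
  have T2 : Tendsto (fun n : ℕ => ∫ p, G p * (σ p / ((1 / ((n:ℝ) + 1)) ^ 2 + σ p ^ 2)) ∂m) atTop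
      (nhds (∫ p, G p / σ p ∂m)) := by
    apply tendsto_integral_of_dominated_convergence _ _ hGσ.norm
    · intro n
      filter_upwards [hσ] with p hp
      rw [div_eq_mul_inv (G p), norm_mul, norm_mul]
      gcongr
      rw [Real.norm_of_nonneg (by positivity), Real.norm_of_nonneg (by positivity), ← one_div,
        div_le_div_iff₀ (by positivity) hp]
      nlinarith [sq_nonneg (1 / ((n:ℝ) + 1))]
    · filter_upwards [hσ] with p hp
      have h0 : Tendsto (fun n : ℕ => (1 / ((n:ℝ) + 1)) ^ 2 + σ p ^ 2) atTop
          (nhds (0 ^ 2 + σ p ^ 2)) := (ht.pow 2).add_const _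
      have := ((tendsto_const_nhds (x := σ p)).div h0 (by positivity)).const_mul (G p)
      have e0 : G p / σ p = G p * (σ p / (0 ^ 2 + σ p ^ 2)) := by
        have := hp.ne'
        rw [zero_pow two_ne_zero, zero_add]
        field_simp
      rw [e0]
      exact this
    · intro n
      apply AEStronglyMeasurable.mul hG.aestronglyMeasurable
      apply Measurable.aestronglyMeasurable
      fun_prop
  rw [hR]
  refine tendsto_nhds_unique T1 (T2.congr fun n => (hL _ (hpos n)).symm)

open scoped FourierTransform in
theorem hh_real (lam : ℝ) (hlam : lam ^ 2 < 2) (g : ℝ → ℝ)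
    (h1 : IntegrableOn g (Ioi (0 : ℝ)))
    (h2 : MemLp g 2 (volume.restrict (Ioi (0 : ℝ))))
    (hm : IntegrableOn (fun t : ℝ => g t / Real.sqrt t) (Ioi 0))
    (heig : ∀ᵐ x ∂(volume.restrict (Ioi (0 : ℝ))),
      Real.sqrt (2 / π) * ∫ t in Ioi (0 : ℝ), (Real.cos (x * t) + Real.sin (x * t)) * g t =
        lam * g x) :
    g =ᵐ[volume.restrict (Ioi (0 : ℝ))] 0 := by
  set ν : Measure ℝ := volume.restrict (Ioi (0 : ℝ)) with hν
  have hcos : ∀ x : ℝ, Integrable (fun t => g t * Real.cos (x * t)) ν := by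
    intro x
    refine Integrable.mono h1 (h1.aestronglyMeasurable.mul (by fun_prop)) (Eventually.of_forall fun t => ?_)
    rw [norm_mul]
    exact mul_le_of_le_one_right (norm_nonneg _) (Real.abs_cos_le_one _)
  have hsin : ∀ x : ℝ, Integrable (fun t => g t * Real.sin (x * t)) ν := by
    intro x
    refine Integrable.mono h1 (h1.aestronglyMeasurable.mul (by fun_prop)) (Eventually.of_forall fun t => ?_)
    rw [norm_mul]
    exact mul_le_of_le_one_right (norm_nonneg _) (Real.abs_sin_le_one _)
  set C : ℝ → ℝ := fun x => ∫ t, g t * Real.cos (x * t) ∂ν with hC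
  set S : ℝ → ℝ := fun x => ∫ t, g t * Real.sin (x * t) ∂ν with hS
  -- Plancherel
  set f : ℝ → ℂ := (Ioi (0:ℝ)).indicator (fun t => (g t : ℂ)) with hf
  have hf1 : Integrable f := by
    rw [hf, integrable_indicator_iff measurableSet_Ioi]
    exact h1.ofReal
  have hf2 : MemLp f 2 := by
    rw [hf, memLp_indicator_iff_restrict measurableSet_Ioi]
    exact h2.ofReal
  obtain ⟨Fc, F2, Fn⟩ := hh_plancherel_s19 f hf1 hf2
  have hF : ∀ ξ, 𝓕 f ξ = (C (2 * π * ξ) : ℂ) - (S (2 * π * ξ) : ℂ) * Complex.I := by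
    intro ξ
    rw [Real.fourier_real_eq_integral_exp_smul]
    have : (fun v : ℝ => Complex.exp (↑(-2 * π * v * ξ) * Complex.I) • f v)
        = (Ioi (0:ℝ)).indicator (fun v => ((g v * Real.cos (2 * π * ξ * v) : ℝ) : ℂ)
          - ((g v * Real.sin (2 * π * ξ * v) : ℝ) : ℂ) * Complex.I) := by
      ext v
      by_cases hv : v ∈ Ioi (0:ℝ)
      · rw [hf, indicator_of_mem hv, indicator_of_mem hv, Complex.exp_mul_I,
          show (-2 * π * v * ξ) = -(2 * π * ξ * v) by ring, ← Complex.ofReal_cos,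
          ← Complex.ofReal_sin, Real.cos_neg, Real.sin_neg, smul_eq_mul]
        push_cast
        ring
      · rw [hf, indicator_of_notMem hv, indicator_of_notMem hv, smul_zero]
    rw [this, integral_indicator measurableSet_Ioi, integral_sub, integral_mul_const,
      integral_complex_ofReal, integral_complex_ofReal]
    · exact (hcos _).ofReal
    · exact ((hsin _).ofReal).mul_const _
  have hFn : ∀ ξ, ‖𝓕 f ξ‖ ^ 2 = C (2 * π * ξ) ^ 2 + S (2 * π * ξ) ^ 2 := by
    intro ξ
    rw [hF, ← Complex.normSq_eq_norm_sq, Complex.normSq_apply]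
    simp
    ring
  have hCc : Continuous C := by
    have : C = fun x => (𝓕 f (x / (2 * π))).re := by
      ext x
      rw [hF, mul_div_cancel₀ _ (by positivity)]
      simp
    rw [this]
    fun_prop
  have hSc : Continuous S := by
    have : S = fun x => -(𝓕 f (x / (2 * π))).im := by
      ext x
      rw [hF, mul_div_cancel₀ _ (by positivity)]
      simp
    rw [this]
    fun_prop
  set Q : ℝ → ℝ := fun x => C x ^ 2 + S x ^ 2 with hQ
  have hQi : Integrable Q := by
    have h := (memLp_two_iff_integrable_sq_norm F2.1).1 F2
    simp_rw [hFn] at h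
    exact (integrable_comp_mul_left_iff Q (R := 2 * π) (by positivity)).1 h
  have hg2 : Integrable (fun t => g t ^ 2) ν := (memLp_two_iff_integrable_sq h2.1).1 h2
  have hfn : ∫ x, ‖f x‖ ^ 2 = ∫ t, g t ^ 2 ∂ν := by
    rw [hν, ← integral_indicator measurableSet_Ioi]
    congr 1; ext v
    by_cases hv : v ∈ Ioi (0:ℝ)
    · simp [hf, indicator_of_mem hv]
    · rw [hf, indicator_of_notMem hv, indicator_of_notMem hv]; simp
  have hQn : ∫ x, Q x ∂ν = π * ∫ t, g t ^ 2 ∂ν := by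
    have e1 : ∫ x, Q (2 * π * x) = ∫ t, g t ^ 2 ∂ν := by
      rw [← hfn, ← Fn]
      congr 1; ext ξ; rw [hFn]
    rw [Measure.integral_comp_mul_left Q (2 * π)] at e1
    have e2 : ∫ x, Q |x| = 2 * ∫ x, Q x ∂ν := integral_comp_abs
    have e3 : (fun x => Q |x|) = Q := by
      ext x
      rcases abs_choice x with h | h
      · rw [h]
      · rw [h]
        simp only [hQ, hC, hS, neg_mul, Real.cos_neg, Real.sin_neg, mul_neg, integral_neg, neg_sq]
    rw [e3] at e2
    rw [e2, abs_of_pos (by positivity), smul_eq_mul] at e1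
    rw [← e1]
    field_simp
  -- the cross term
  have hpw : ∀ x, 2 * (C x * S x) =
      ∫ p, (g p.1 * g p.2) * Real.sin (x * (p.1 + p.2)) ∂(ν.prod ν) := by
    intro x
    have e : (fun p : ℝ × ℝ => (g p.1 * g p.2) * Real.sin (x * (p.1 + p.2)))
        = fun p => (g p.1 * Real.sin (x * p.1)) * (g p.2 * Real.cos (x * p.2))
          + (g p.1 * Real.cos (x * p.1)) * (g p.2 * Real.sin (x * p.2)) := by
      ext p
      rw [mul_add, Real.sin_add]; ring
    rw [e, integral_add ((hsin x).mul_prod (hcos x)) ((hcos x).mul_prod (hsin x)),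
      integral_prod_mul (fun t => g t * Real.sin (x * t)) (fun t => g t * Real.cos (x * t)),
      integral_prod_mul (fun t => g t * Real.cos (x * t)) (fun t => g t * Real.sin (x * t))]
    simp only [hC, hS]; ring
  have hCSi : Integrable (fun x => 2 * (C x * S x)) ν := by
    refine (hQi.mono_measure Measure.restrict_le_self).mono (by fun_prop)
      (Eventually.of_forall fun x => ?_)
    rw [Real.norm_eq_abs, Real.norm_eq_abs, abs_of_nonneg (by positivity : 0 ≤ Q x), abs_le]
    simp only [hQ]
    constructor <;> nlinarith [sq_nonneg (C x - S x), sq_nonneg (C x + S x)]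
  have hpos : ∀ᵐ p ∂(ν.prod ν), 0 < p.1 ∧ 0 < p.2 := by
    rw [hν, Measure.prod_restrict]
    filter_upwards [ae_restrict_mem (measurableSet_Ioi.prod measurableSet_Ioi)] with p hp
    exact hp
  have hCS : 0 ≤ ∫ x, 2 * (C x * S x) ∂ν := by
    simp_rw [hpw] at hCSi ⊢
    rw [hν] at hCSi ⊢
    rw [hh_fubini_s19 _ (fun p : ℝ × ℝ => g p.1 * g p.2) (fun p => p.1 + p.2) (by fun_prop)
      (by filter_upwards [hpos] with p hp; linarith [hp.1, hp.2]) (h1.mul_prod h1) ?_ hCSi]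
    · apply integral_nonneg
      intro u
      have e : (fun p : ℝ × ℝ => g p.1 * g p.2 * Real.exp (-(u * (p.1 + p.2))))
        = fun p => (g p.1 * Real.exp (-(u * p.1))) * (g p.2 * Real.exp (-(u * p.2))) := by
        ext p
        rw [mul_add, neg_add, Real.exp_add]; ring
      simp only [Pi.zero_apply]
      rw [e, integral_prod_mul (fun t => g t * Real.exp (-(u * t)))
        (fun t => g t * Real.exp (-(u * t)))]
      exact mul_self_nonneg _
    · refine (hm.mul_prod hm).mono ?_ ?_
      · have : AEStronglyMeasurable (fun p : ℝ × ℝ => g p.1 * g p.2) (ν.prod ν) :=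
          (h1.mul_prod h1).aestronglyMeasurable
        have h' : AEStronglyMeasurable (fun p : ℝ × ℝ => (p.1 + p.2)⁻¹) (ν.prod ν) :=
          Measurable.aestronglyMeasurable (by fun_prop)
        simp only [div_eq_mul_inv]
        exact this.mul h'
      · filter_upwards [hpos] with p hp
        obtain ⟨hp1, hp2⟩ := hp
        have s1 := Real.sqrt_pos.2 hp1
        have s2 := Real.sqrt_pos.2 hp2
        rw [div_mul_div_comm, norm_div, norm_div]
        gcongr
        · simp only [Real.norm_eq_abs]
          rw [abs_of_pos (mul_pos s1 s2)]
          positivity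
        rw [Real.norm_of_nonneg (by positivity), Real.norm_of_nonneg (by positivity)]
        nlinarith [sq_nonneg (Real.sqrt p.1 - Real.sqrt p.2), Real.sq_sqrt hp1.le,
          Real.sq_sqrt hp2.le, mul_pos s1 s2]
  -- conclusion
  have hfin : ∫ x, lam ^ 2 * g x ^ 2 ∂ν = ∫ x, 2 / π * (Q x + 2 * (C x * S x)) ∂ν := by
    apply integral_congr_ae
    filter_upwards [heig] with x hx
    have e : ∫ t, (Real.cos (x * t) + Real.sin (x * t)) * g t ∂ν = C x + S x := by
      simp only [hC, hS]
      rw [← integral_add (hcos x) (hsin x)]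
      congr 1; ext t; ring
    rw [e] at hx
    rw [← mul_pow, ← hx, mul_pow, Real.sq_sqrt (by positivity)]
    simp only [hQ]; ring
  rw [integral_const_mul, integral_const_mul,
    integral_add (hQi.mono_measure Measure.restrict_le_self) hCSi, hQn, mul_add,
    ← mul_assoc, div_mul_cancel₀ _ Real.pi_ne_zero] at hfin
  have h0 : 0 ≤ 2 / π * ∫ x, 2 * (C x * S x) ∂ν := by positivity
  have hge : 0 ≤ ∫ t, g t ^ 2 ∂ν := integral_nonneg fun t => sq_nonneg _
  have hz : ∫ t, g t ^ 2 ∂ν = 0 := by nlinarith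
  rw [integral_eq_zero_iff_of_nonneg (fun t => sq_nonneg _) hg2] at hz
  filter_upwards [hz] with t ht
  simpa using ht

/-- Triviality of eigenfunctions of the half-Hartley transform for real `λ` with
`λ² < 2`: if `|λ| < √2` and `H₊f = λ f` a.e. on `(0,∞)`, then `f = 0` a.e. on `(0,∞)`. -/
theorem halfHartley_eigen_trivial (lam : ℝ) (hlam : |lam| < Real.sqrt 2)
    (f : ℝ → ℂ)
    (h1 : IntegrableOn f (Ioi (0 : ℝ)))
    (h2 : MemLp f 2 (volume.restrict (Ioi (0 : ℝ))))
    (hm : IntegrableOn (fun t : ℝ => ‖f t‖ / Real.sqrt t) (Ioi 0))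
    (heig : ∀ᵐ x ∂(volume.restrict (Ioi (0 : ℝ))),
      (Real.sqrt (2 / π) : ℂ) *
          ∫ t in Ioi (0 : ℝ), ((Real.cos (x * t) + Real.sin (x * t) : ℝ) : ℂ) * f t =
        (lam : ℂ) * f x) :
    f =ᵐ[volume.restrict (Ioi (0 : ℝ))] 0 := by
  have hl : lam ^ 2 < 2 := by
    rw [← sq_abs, ← Real.sq_sqrt (zero_le_two : (0:ℝ) ≤ 2)]
    exact pow_lt_pow_left₀ hlam (abs_nonneg _) two_ne_zero
  have hi : ∀ x : ℝ, IntegrableOn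
      (fun t => ((Real.cos (x * t) + Real.sin (x * t) : ℝ) : ℂ) * f t) (Ioi (0:ℝ)) := by
    intro x
    refine (h1.norm.const_mul 2).mono' (AEStronglyMeasurable.mul
      (Continuous.aestronglyMeasurable (by fun_prop)) h1.aestronglyMeasurable)
      (Eventually.of_forall fun t => ?_)
    rw [norm_mul, Complex.norm_real, Real.norm_eq_abs]
    gcongr
    refine (abs_add_le _ _).trans ?_
    linarith [Real.abs_cos_le_one (x * t), Real.abs_sin_le_one (x * t)]
  have hre : (fun t => (f t).re) =ᵐ[volume.restrict (Ioi (0 : ℝ))] 0 := by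
    refine hh_real lam hl _ h1.re h2.re ?_ ?_
    · refine Integrable.mono hm (AEStronglyMeasurable.div₀ h1.re.aestronglyMeasurable
        (Measurable.aestronglyMeasurable (by fun_prop))) (Eventually.of_forall fun t => ?_)
      rw [norm_div, norm_div, norm_norm]
      gcongr
      exact Complex.abs_re_le_norm _
    · filter_upwards [heig] with x hx
      have h := congrArg Complex.re hx
      rw [Complex.re_ofReal_mul, Complex.re_ofReal_mul] at h
      rw [← h]
      congr 1
      refine Eq.trans ?_ (integral_re (hi x))
      congr 1; ext t
      exact (Complex.re_ofReal_mul _ _).symm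
  have him : (fun t => (f t).im) =ᵐ[volume.restrict (Ioi (0 : ℝ))] 0 := by
    refine hh_real lam hl _ h1.im h2.im ?_ ?_
    · refine Integrable.mono hm (AEStronglyMeasurable.div₀ h1.im.aestronglyMeasurable
        (Measurable.aestronglyMeasurable (by fun_prop))) (Eventually.of_forall fun t => ?_)
      rw [norm_div, norm_div, norm_norm]
      gcongr
      exact Complex.abs_im_le_norm _
    · filter_upwards [heig] with x hx
      have h := congrArg Complex.im hx
      rw [Complex.im_ofReal_mul, Complex.im_ofReal_mul] at h
      rw [← h]
      congr 1
      refine Eq.trans ?_ (integral_im (hi x))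
      congr 1; ext t
      exact (Complex.im_ofReal_mul _ _).symm
  filter_upwards [hre, him] with t a b
  exact Complex.ext a b
end
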